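/- Let (T,(X_1,…,X_s)) be a tableau with substitution of dimension (n_1,…,n_m) with distinguished columns q_1 = m−1, q_2 = m and n_{q_1} = n_{q_2} = n. Let τ ∈ S_n and let (β,γ,b,c) ∈ Q_T be the (unique up to equivalence) T-admissible quadruple with τ ∈ S_{β,γ,b,c}. Then #S_τ = c_T^{(q_1,q_2)} / (β! · c(λ(τ))), where β! = β_1!⋯β_p!, c_T^{(q_1,q_2)} = ∏_{j=1}^s #{a ∈ T | φ(a) = j and (a' > m−2 or a'' > m−2)}!, λ(τ) = (λ_1,…,λ_q) is the multi-partition of γ determined by φ(T^τ_cl), and c(λ(τ)) = ∏_{i=1}^q c(λ_i) with c(ν) = ν_1⋯ν_l · ∏_{r>0} #{i | ν_i = r}! for a partition ν = (ν_1,…,ν_l). -/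

import Mathlib

open scoped BigOperators
set_option linter.unusedVariables false

attribute [local instance] Classical.propDecidable

/-- The cells of a shape of dimension `n : ι → ℕ`: the column `i` has `n i` cells. -/
abbrev TabCell {ι : Type} (n : ι → ℕ) : Type := Σ i : ι, Fin (n i)

/-- A tableau with substitution `(T,(X_1,…,X_s))` of dimension `n : ι → ℕ` with entries
in `A`.  Cells are paired by the involution `mate` (each pair of cells is an arrow going
from the tail cell, where `isTail` holds, to the head cell); `lab` assigns to every
arrow (encoded via either of its two cells) its index `φ ∈ {1,…,s}`; `X j` is the matrix
assigned to the arrows with label `j`, which is an `n_{a''} × n_{a'}` matrix where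
`colTail j = a''` and `colHead j = a'` are the tail and head columns of those arrows. -/
structure TabSub (A : Type) [CommRing A] (ι : Type) [Fintype ι] [DecidableEq ι]
    (n : ι → ℕ) (s : ℕ) where
  mate : Equiv.Perm (TabCell n)
  isTail : TabCell n → Bool
  lab : TabCell n → Fin s
  colTail : Fin s → ι
  colHead : Fin s → ι
  X : ∀ j : Fin s, Matrix (Fin (n (colTail j))) (Fin (n (colHead j))) A
  mate_ne : ∀ c, mate c ≠ c
  mate_invol : ∀ c, mate (mate c) = c
  isTail_mate : ∀ c, isTail (mate c) = !isTail c
  lab_mate : ∀ c, lab (mate c) = lab c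
  lab_surj : ∀ j : Fin s, ∃ c, isTail c = true ∧ lab c = j
  colTail_eq : ∀ c, isTail c = true → colTail (lab c) = c.1
  colHead_eq : ∀ c, isTail c = true → colHead (lab c) = (mate c).1

namespace TabSub

variable {A : Type} [CommRing A] {ι : Type} [Fintype ι] [DecidableEq ι] {n : ι → ℕ} {s : ℕ}

/-- The entry of a (rectangular) matrix at a pair of natural number indices, extended
by zero outside the range. -/
def castEntry {a b : ι} (M : Matrix (Fin (n a)) (Fin (n b)) A) (i j : ℕ) : A :=
  if h : i < n a ∧ j < n b then M ⟨i, h.1⟩ ⟨j, h.2⟩ else 0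

/-- The set of tail cells of a tableau; tail cells are in bijection with arrows. -/
noncomputable def tails (T : TabSub A ι n s) : Finset (TabCell n) :=
  Finset.univ.filter fun c => T.isTail c = true

/-- `sgn(π_1)⋯sgn(π_m)` for a tuple of permutations of the columns. -/
def sgnT (π : ∀ i : ι, Equiv.Perm (Fin (n i))) : ℤ :=
  ∏ i, (Equiv.Perm.sign (π i) : ℤ)

/-- The factor `(X_{φ(a)})_{π_{a''}(''a), π_{a'}('a)}` contributed by the arrow with
tail cell `c`. -/
def entry (T : TabSub A ι n s) (π : ∀ i : ι, Equiv.Perm (Fin (n i))) (c : TabCell n) : A :=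
  castEntry (T.X (T.lab c)) (π c.1 c.2 : Fin (n c.1)).1
    ((π (T.mate c).1 (T.mate c).2 : Fin (n (T.mate c).1)).1)

/-- `bpf⁰_T(X_1,…,X_s)`: the sum over all tuples of permutations. -/
noncomputable def bpf0 (T : TabSub A ι n s) : A :=
  ∑ π : ∀ i : ι, Equiv.Perm (Fin (n i)), sgnT π • ∏ c ∈ T.tails, T.entry π c

/-- The condition on a tuple of permutations appearing in `bpf`: whenever
`φ(a) = φ(b)` and `''a < ''b` then `π_i(''a) < π_i(''b)`. -/
def SortedPi (T : TabSub A ι n s) (π : ∀ i : ι, Equiv.Perm (Fin (n i))) : Prop :=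
  ∀ c ∈ T.tails, ∀ d ∈ T.tails, T.lab c = T.lab d → (c.2 : ℕ) < (d.2 : ℕ) →
    ((π c.1 c.2 : Fin (n c.1)) : ℕ) < ((π d.1 d.2 : Fin (n d.1)) : ℕ)

/-- `bpf_T(X_1,…,X_s)`. -/
noncomputable def bpf (T : TabSub A ι n s) : A :=
  ∑ π ∈ Finset.univ.filter T.SortedPi, sgnT π • ∏ c ∈ T.tails, T.entry π c

/-- Conjugating a tableau with substitution by a column-preserving permutation of the
cells. -/
def permTab (T : TabSub A ι n s) (ρ : Equiv.Perm (TabCell n))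
    (hρ : ∀ c, (ρ c).1 = c.1) : TabSub A ι n s where
  mate := (ρ.symm.trans T.mate).trans ρ
  isTail c := T.isTail (ρ.symm c)
  lab c := T.lab (ρ.symm c)
  colTail := T.colTail
  colHead := T.colHead
  X := T.X
  mate_ne c h := by
    refine T.mate_ne (ρ.symm c) ?_
    simpa using congrArg ρ.symm h
  mate_invol c := by simp [T.mate_invol]
  isTail_mate c := by simpa using T.isTail_mate (ρ.symm c)
  lab_mate c := by simpa using T.lab_mate (ρ.symm c)
  lab_surj j := by
    obtain ⟨c, hc1, hc2⟩ := T.lab_surj j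
    exact ⟨ρ c, by simpa using hc1, by simpa using hc2⟩
  colTail_eq c h := by
    have h1 := T.colTail_eq (ρ.symm c) h
    have h2 : (ρ (ρ.symm c)).1 = (ρ.symm c).1 := hρ (ρ.symm c)
    simpa [h1] using h2.symm
  colHead_eq c h := by
    have h1 := T.colHead_eq (ρ.symm c) h
    have h2 := hρ (T.mate (ρ.symm c))
    simp only [Equiv.trans_apply]
    rw [h1, h2]

/-- The permutation of the cells permuting the cells of column `q` by `τ`. -/
def colPerm (n : ι → ℕ) (q : ι) (τ : Equiv.Perm (Fin (n q))) : Equiv.Perm (TabCell n) :=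
  Equiv.sigmaCongrRight fun i =>
    if h : i = q then ((finCongr (congrArg n h)).permCongr.symm τ) else Equiv.refl _

/-- The tableau `T^τ` obtained from `T` by permuting the cells of column `q` by `τ`. -/
def tw (T : TabSub A ι n s) (q : ι) (τ : Equiv.Perm (Fin (n q))) : TabSub A ι n s :=
  T.permTab (colPerm n q τ) (fun _ => rfl)

end TabSub

namespace TabSub

variable {A : Type} [CommRing A] {ι : Type} [Fintype ι] [DecidableEq ι] {n : ι → ℕ} {s : ℕ}

/-! ### Oriented arrows, paths, and the matrices they carry

An element `a ∈t T` (an arrow of `T` or the transpose of one) is encoded by a cell `c`: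
the oriented arrow with tail cell `c` and head cell `T.mate c`.  If `c` is a tail cell
this is the arrow itself, otherwise it is the transpose of an arrow. -/

/-- The letter `φ(a) ∈ M_T` of an oriented arrow: its label together with a flag telling
whether it is transposed. -/
def letter (T : TabSub A ι n s) (c : TabCell n) : Fin s × Bool := (T.lab c, !T.isTail c)

/-- The word `φ(a_1)⋯φ(a_r) ∈ M_T` of a word of oriented arrows. -/
def word (T : TabSub A ι n s) (l : List (TabCell n)) : List (Fin s × Bool) :=
  l.map T.letter

/-- The entries (as a function on natural number indices, extended by zero) of the
matrix `X_{φ(a)}` assigned to an oriented arrow: rows are indexed by its tail column,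
columns by its head column; for a transposed arrow this is the transposed matrix. -/
def matOf (T : TabSub A ι n s) (c : TabCell n) : ℕ → ℕ → A :=
  fun i j => if T.isTail c then castEntry (T.X (T.lab c)) i j else castEntry (T.X (T.lab c)) j i

/-- The product of a list of `ℕ×ℕ`-indexed matrices, all summations being over
`Finset.range B`. -/
def matListProd (B : ℕ) : List (ℕ → ℕ → A) → ℕ → ℕ → A
  | [] => fun i j => if i = j then 1 else 0
  | f :: fs => fun i j => ∑ p ∈ Finset.range B, f i p * matListProd B fs p j

/-- A bound exceeding the sizes of all matrices involved. -/
def dimBound (n : ι → ℕ) [Fintype ι] : ℕ := ∑ i, n i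

/-- The entries of the product matrix `X_{φ(a_1)}⋯X_{φ(a_r)}` of a word of oriented
arrows (the product being `0` if the sizes do not match). -/
def pathMat (T : TabSub A ι n s) (l : List (TabCell n)) : ℕ → ℕ → A :=
  matListProd (dimBound n) (l.map T.matOf)

/-- The trace of the matrix of a (closed) word of oriented arrows. -/
def pathTr (T : TabSub A ι n s) (l : List (TabCell n)) : A :=
  ∑ p ∈ Finset.range (dimBound n), T.pathMat l p p

/-- The entries of the matrix `X_u` of a word `u ∈ M_T` in the letters
`1,…,s,1ᵗ,…,sᵗ` (the product being `0` if the sizes do not match). -/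
def wordMat (T : TabSub A ι n s) (w : List (Fin s × Bool)) : ℕ → ℕ → A :=
  matListProd (dimBound n)
    (w.map fun p => fun i j =>
      if p.2 then castEntry (T.X p.1) j i else castEntry (T.X p.1) i j)

/-- `σ_k(X)`: the coefficient in the characteristic polynomial defined by
`det(λE − X) = λ^n − σ_1(X)λ^{n−1} + ⋯ + (−1)^n σ_n(X)`. -/
noncomputable def sigmaCoeff (N : ℕ) (M : Matrix (Fin N) (Fin N) A) (k : ℕ) : A :=
  (-1) ^ k * (Matrix.charpoly M).coeff (N - k)

/-- `σ_k(X_u)` for a word `u ∈ M_T`. -/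
noncomputable def wordSigma (T : TabSub A ι n s) (w : List (Fin s × Bool)) (k : ℕ) : A :=
  sigmaCoeff (dimBound n) (Matrix.of fun i j : Fin (dimBound n) => T.wordMat w i j) k

/-- Oriented arrows `a_1, a_2` are successive (with respect to the distinguished columns
`q_1, q_2`): `a_1', a_2'' ∈ {q_1,q_2}`, `a_1' ≠ a_2''` and `'a_1 = ''a_2`. -/
def Succ (T : TabSub A ι n s) (q1 q2 : ι) (c d : TabCell n) : Prop :=
  ((T.mate c).1 = q1 ∨ (T.mate c).1 = q2) ∧ (d.1 = q1 ∨ d.1 = q2) ∧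
    (T.mate c).1 ≠ d.1 ∧ ((T.mate c).2 : ℕ) = (d.2 : ℕ)

/-- A path in `T` with respect to the columns `q_1` and `q_2`: a (nonempty, repetition
free) word of oriented arrows in which consecutive arrows are successive. -/
def IsPath (T : TabSub A ι n s) (q1 q2 : ι) (l : List (TabCell n)) : Prop :=
  l ≠ [] ∧ l.Chain' (T.Succ q1 q2) ∧ l.Nodup

/-- An open path: a path passing through the columns `q_1,q_2` whose first tail and
last head lie outside `{q_1,q_2}`. -/
def IsOpenPath (T : TabSub A ι n s) (q1 q2 : ι) (l : List (TabCell n)) : Prop :=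
  T.IsPath q1 q2 l ∧ 2 ≤ l.length ∧ ∀ h : l ≠ [],
    ((l.head h).1 ≠ q1 ∧ (l.head h).1 ≠ q2) ∧
    ((T.mate (l.getLast h)).1 ≠ q1 ∧ (T.mate (l.getLast h)).1 ≠ q2)

/-- A closed path: a path whose last and first arrows are also successive. -/
def IsClosedPath (T : TabSub A ι n s) (q1 q2 : ι) (l : List (TabCell n)) : Prop :=
  T.IsPath q1 q2 l ∧ ∀ h : l ≠ [], T.Succ q1 q2 (l.getLast h) (l.head h)

/-- The transpose `aᵗ = a_rᵗ⋯a_1ᵗ` of a word of oriented arrows. -/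
def tp (T : TabSub A ι n s) (l : List (TabCell n)) : List (TabCell n) :=
  (l.map T.mate).reverse

/-- Equality of words of oriented arrows up to transposition (`=t`). -/
def eqT (T : TabSub A ι n s) (l l' : List (TabCell n)) : Prop :=
  l = l' ∨ l = T.tp l'

/-- Equality of words of oriented arrows up to cyclic permutation and transposition
(`=ct`). -/
def eqCT (T : TabSub A ι n s) (l l' : List (TabCell n)) : Prop :=
  l.IsRotated l' ∨ l.IsRotated (T.tp l')

/-- `R` is a set of representatives of the open paths of `T` (w.r.t. `q_1,q_2`) modulo
the `=t`-equivalence. -/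
def OpenReps (T : TabSub A ι n s) (q1 q2 : ι) (R : Finset (List (TabCell n))) : Prop :=
  (∀ l ∈ R, T.IsOpenPath q1 q2 l) ∧
  ∀ l, T.IsOpenPath q1 q2 l → ∃! l', l' ∈ R ∧ T.eqT l l'

/-- `R` is a set of representatives of the closed paths of `T` (w.r.t. `q_1,q_2`)
modulo the `=ct`-equivalence. -/
def ClosedReps (T : TabSub A ι n s) (q1 q2 : ι) (R : Finset (List (TabCell n))) : Prop :=
  (∀ l ∈ R, T.IsClosedPath q1 q2 l) ∧
  ∀ l, T.IsClosedPath q1 q2 l → ∃! l', l' ∈ R ∧ T.eqCT l l'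

/-- `tr(T_cl) = ∏_{a ∈ T_cl} tr(X_{φ(a)})` for a set `R` of representatives of the
closed paths. -/
noncomputable def trClosed (T : TabSub A ι n s) (R : Finset (List (TabCell n))) : A :=
  ∏ l ∈ R, T.pathTr l

end TabSub

/-! ### Words in the free monoid `M_T` -/

/-- The transpose `uᵗ` of a word `u ∈ M_T` in the letters `1,…,s,1ᵗ,…,sᵗ`. -/
def wtp {s : ℕ} (w : List (Fin s × Bool)) : List (Fin s × Bool) :=
  (w.map fun p => (p.1, !p.2)).reverse

/-- Equality of words in `M_T` up to transposition (`=t`). -/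
def weqT {s : ℕ} (w w' : List (Fin s × Bool)) : Prop := w = w' ∨ w = wtp w'

/-- Equality of words in `M_T` up to cyclic permutation and transposition (`=ct`). -/
def weqCT {s : ℕ} (w w' : List (Fin s × Bool)) : Prop :=
  w.IsRotated w' ∨ w.IsRotated (wtp w')

/-- A word in a free monoid is primitive if it is not a power (with at least two
factors) of a word. -/
def PrimitiveWord {α : Type*} (w : List α) : Prop :=
  w ≠ [] ∧ ∀ (u : List α) (r : ℕ), 2 ≤ r → w ≠ (List.replicate r u).flatten

namespace TabSub

variable {A : Type} [CommRing A] {ι : Type} [Fintype ι] [DecidableEq ι] {n : ι → ℕ} {s : ℕ}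

/-! ### The tableau `T̃` -/

/-- The inclusion of the cells of the shape with the columns `q_1, q_2` deleted into the
cells of the original shape. -/
def embCell (q1 q2 : ι) (c : TabCell (fun i : {i : ι // i ≠ q1 ∧ i ≠ q2} => n i.1)) :
    TabCell n := ⟨c.1.1, c.2⟩

/-- The word in `M_T` corresponding to an arrow of `T̃` with tail cell `c'`: for an old
arrow (Case A) it is the single letter `φ(a)`; for an arrow coming from an open path
`l ∈ Ro` starting at `c'` (Case B) it is `φ(l)`. -/
noncomputable def tildeWord (T : TabSub A ι n s) (q1 q2 : ι)
    (Ro : Finset (List (TabCell n)))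
    (c' : TabCell (fun i : {i : ι // i ≠ q1 ∧ i ≠ q2} => n i.1)) : List (Fin s × Bool) :=
  if ((T.mate (embCell q1 q2 c')).1 ≠ q1 ∧ (T.mate (embCell q1 q2 c')).1 ≠ q2) then
    [T.letter (embCell q1 q2 c')]
  else
    T.word ((Ro.filter fun l => l.head? = some (embCell q1 q2 c')).toList.headI)

end TabSub

namespace TabSub

variable {A : Type} [CommRing A] {ι : Type} [Fintype ι] [DecidableEq ι] {n : ι → ℕ} {s : ℕ}

/-- `D` is (a tableau with substitution equal to) the tableau `T̃` associated with `T`,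
the columns `q_1, q_2`, and the set `Ro` of representatives of open paths.  Its arrows
are the arrows of `T` lying entirely outside the columns `q_1, q_2` (Case A, carrying
the same matrices), together with one arrow for each open path `l ∈ Ro`, going from the
tail of the first arrow of `l` to the head of its last arrow and carrying the matrix
`X_{φ(l)}` (Case B); two arrows of `D` carry the same label iff the corresponding words
in `M_T` coincide. -/
def IsTilde (T : TabSub A ι n s) (q1 q2 : ι) (Ro : Finset (List (TabCell n))) {t : ℕ}
    (D : TabSub A {i : ι // i ≠ q1 ∧ i ≠ q2} (fun i => n i.1) t) : Prop :=
  (∀ c' : TabCell (fun i : {i : ι // i ≠ q1 ∧ i ≠ q2} => n i.1),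
    ((T.mate (embCell q1 q2 c')).1 ≠ q1 ∧ (T.mate (embCell q1 q2 c')).1 ≠ q2) →
      D.isTail c' = T.isTail (embCell q1 q2 c') ∧
      embCell q1 q2 (D.mate c') = T.mate (embCell q1 q2 c') ∧
      ∀ i j, D.matOf c' i j = T.matOf (embCell q1 q2 c') i j) ∧
  (∀ l ∈ Ro, ∀ (h : l ≠ []) (h1 : (l.head h).1 ≠ q1 ∧ (l.head h).1 ≠ q2),
      D.isTail ⟨⟨(l.head h).1, h1⟩, (l.head h).2⟩ = true ∧
      embCell q1 q2 (D.mate ⟨⟨(l.head h).1, h1⟩, (l.head h).2⟩) = T.mate (l.getLast h) ∧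
      ∀ i j, D.matOf ⟨⟨(l.head h).1, h1⟩, (l.head h).2⟩ i j = T.pathMat l i j) ∧
  (∀ c' d', D.isTail c' = true → D.isTail d' = true →
      (D.lab c' = D.lab d' ↔ tildeWord T q1 q2 Ro c' = tildeWord T q1 q2 Ro d'))

end TabSub

/-! ### Quadruples and the sets `S_τ`, `S_{β,γ,b,c}` -/

/-- The data of a quadruple `(β,γ,b,c)` with `β ∈ ℕ^p`, `γ ∈ ℕ^q` and `b`, `c`
sequences of words in `M_T`. -/
structure QuadData (s : ℕ) where
  p : ℕ
  q : ℕ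
  β : Fin p → ℕ
  γ : Fin q → ℕ
  b : Fin p → List (Fin s × Bool)
  c : Fin q → List (Fin s × Bool)

namespace QuadData

variable {s : ℕ}

/-- `(β,γ,b,c)` is a `T`-quadruple: the `b_i`, `c_j` are primitive, the `b_i` are
pairwise different with respect to `=t` and the `c_j` pairwise different with respect
to `=ct`. -/
def IsQuad (Q : QuadData s) : Prop :=
  (∀ i, PrimitiveWord (Q.b i)) ∧ (∀ j, PrimitiveWord (Q.c j)) ∧
  (∀ i i', i ≠ i' → ¬ weqT (Q.b i) (Q.b i')) ∧
  (∀ j j', j ≠ j' → ¬ weqCT (Q.c j) (Q.c j'))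

/-- The multiset `{{b_1,…,b_1,…,b_p,…,b_p}}` with `b_i` of multiplicity `β_i`. -/
def mB (Q : QuadData s) : Multiset (List (Fin s × Bool)) :=
  ∑ i, Multiset.replicate (Q.β i) (Q.b i)

/-- The multiset `{{c_1,…,c_1,…,c_q,…,c_q}}` with `c_j` of multiplicity `γ_j`. -/
def mC (Q : QuadData s) : Multiset (List (Fin s × Bool)) :=
  ∑ j, Multiset.replicate (Q.γ j) (Q.c j)

/-- Equivalence of quadruples: the associated multisets agree up to `=t` (for `b`)
and up to `=ct` (for `c`). -/
def Equiv (Q Q' : QuadData s) : Prop :=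
  Multiset.Rel weqT Q.mB Q'.mB ∧ Multiset.Rel weqCT Q.mC Q'.mC

end QuadData

namespace TabSub

variable {A : Type} [CommRing A] {ι : Type} [Fintype ι] [DecidableEq ι] {n : ι → ℕ} {s : ℕ}

/-- The multiset `φ(T_o)` (or `φ(T_cl)`) of words in `M_T` of a set `R` of
representative paths. -/
def wordsOf (T : TabSub A ι n s) (R : Finset (List (TabCell n))) :
    Multiset (List (Fin s × Bool)) :=
  R.val.map T.word

/-- `ξ` witnesses the `T`-admissibility of the quadruple `Q`, with respect to the given
families `Ro ξ`, `Rcl ξ` of representatives of the open and closed paths of `T^ξ`: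
`φ(T^ξ_o) =t {{b_i with multiplicity β_i}}` and
`φ(T^ξ_cl) =ct {{c_j with multiplicity γ_j}}`. -/
def Witness (T : TabSub A ι n s) (q1 q2 : ι)
    (Ro Rcl : Finset (List (TabCell n))) (Q : QuadData s) : Prop :=
  Multiset.Rel weqT (T.wordsOf Ro) Q.mB ∧ Multiset.Rel weqCT (T.wordsOf Rcl) Q.mC

/-- The quadruple `Q` is `T`-admissible. -/
def Admissible (T : TabSub A ι n s) (q1 q2 : ι) (hn : n q1 = n q2)
    (Ro Rcl : Equiv.Perm (Fin (n q2)) → Finset (List (TabCell n)))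
    (Q : QuadData s) : Prop :=
  Q.IsQuad ∧ ∃ ξ : Equiv.Perm (Fin (n q2)), Witness (T.tw q2 ξ) q1 q2 (Ro ξ) (Rcl ξ) Q

/-- Membership `τ ∈ S_{β,γ,b,c}`: `φ(T^τ_o) =t {{b_i with multiplicity β_i}}` and
`φ(T^τ_cl) =ct {{c_1^{λ_{11}},…,c_1^{λ_{1l_1}},…,c_q^{λ_{q1}},…,c_q^{λ_{ql_q}}}}` for
some positive integers `λ_{ij}` with `λ_{i1}+⋯+λ_{il_i} = γ_i`. -/
def SQuadMem (T : TabSub A ι n s) (q1 q2 : ι)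
    (Ro Rcl : Equiv.Perm (Fin (n q2)) → Finset (List (TabCell n)))
    (Q : QuadData s) (τ : Equiv.Perm (Fin (n q2))) : Prop :=
  Multiset.Rel weqT ((T.tw q2 τ).wordsOf (Ro τ)) Q.mB ∧
  ∃ L : Fin Q.q → Multiset ℕ,
    (∀ j, (∀ x ∈ L j, 0 < x) ∧ (L j).sum = Q.γ j) ∧
    Multiset.Rel weqCT ((T.tw q2 τ).wordsOf (Rcl τ))
      (∑ j, (L j).map fun lam => (List.replicate lam (Q.c j)).flatten)

/-- The set `S_τ` of permutations `π` with `φ(T^π_o) =t φ(T^τ_o)` and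
`φ(T^π_cl) =ct φ(T^τ_cl)`. -/
def SPerm (T : TabSub A ι n s) (q1 q2 : ι)
    (Ro Rcl : Equiv.Perm (Fin (n q2)) → Finset (List (TabCell n)))
    (τ : Equiv.Perm (Fin (n q2))) : Set (Equiv.Perm (Fin (n q2))) :=
  {π | Multiset.Rel weqT ((T.tw q2 π).wordsOf (Ro π)) ((T.tw q2 τ).wordsOf (Ro τ)) ∧
       Multiset.Rel weqCT ((T.tw q2 π).wordsOf (Rcl π)) ((T.tw q2 τ).wordsOf (Rcl τ))}

/-! ### Auxiliary constructions for Lemmas about `T^π` -/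

/-- The word of arrows of `T` underlying a word of arrows of `T^τ`. -/
def underlying (T : TabSub A ι n s) (q2 : ι) (τ : Equiv.Perm (Fin (n q2)))
    (l : List (TabCell n)) : List (TabCell n) :=
  l.map (colPerm n q2 τ).symm

/-- The cell number of a cell lying in column `q_1` or `q_2`, as an element of
`Fin (n q2)` (using `n q1 = n q2`). -/
def toQ2 {q1 q2 : ι} (hn : n q1 = n q2) (c : TabCell n) (h : c.1 = q1 ∨ c.1 = q2) :
    Fin (n q2) :=
  if h2 : c.1 = q2 then Fin.cast (congrArg n h2) c.2
  else Fin.cast ((congrArg n (h.resolve_right h2)).trans hn) c.2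

/-- The substitution `a → b, b → a` on oriented arrows (hence also `aᵗ → bᵗ, bᵗ → aᵗ`). -/
def swapSub (T : TabSub A ι n s) (a b : TabCell n) (c : TabCell n) : TabCell n :=
  if c = a then b else if c = b then a
  else if c = T.mate a then T.mate b else if c = T.mate b then T.mate a else c

end TabSub

/-- `c(ν) = ν_1⋯ν_l · ∏_{r>0} #{i | ν_i = r}!` for a partition (multiset) `ν`. -/
def cPart (ν : Multiset ℕ) : ℕ :=
  ν.prod * ∏ r ∈ ν.toFinset, (ν.count r).factorial

set_option linter.unusedSectionVars false

/-! ### Words -/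

section WordFacts

variable {α : Type*}

/-- Power of a word. -/
def pwW (u : List α) (r : ℕ) : List α := (List.replicate r u).flatten

lemma pwW_succ (u : List α) (r : ℕ) : pwW u (r + 1) = u ++ pwW u r := by
  simp [pwW, List.replicate_succ]

lemma pwW_succ' (u : List α) (r : ℕ) : pwW u (r + 1) = pwW u r ++ u := by
  simp [pwW, List.replicate_succ']

lemma pwW_length (u : List α) (r : ℕ) : (pwW u r).length = r * u.length := by
  simp [pwW]

lemma pwW_getElem (u : List α) (r i : ℕ) (h : i < (pwW u r).length)
    (h' : i % u.length < u.length) : (pwW u r)[i] = u[i % u.length] := by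
  induction r generalizing i with
  | zero => simp [pwW] at h
  | succ r ih =>
    simp only [pwW_succ]
    rw [List.getElem_append]
    split_ifs with h1
    · simp [Nat.mod_eq_of_lt h1]
    · push Not at h1
      have e : (i - u.length) % u.length = i % u.length := (Nat.mod_eq_sub_mod h1).symm
      rw [ih (i - u.length) (by rw [pwW_succ] at h; simp at h; omega) (by rw [e]; exact h')]
      simp only [e]

lemma pwW_rotate (u : List α) (r k : ℕ) : (pwW u r).rotate k = pwW (u.rotate k) r := by
  apply List.ext_getElem
  · simp [pwW_length]
  · intro i h1 h2
    have h3 : i < r * u.length := by simpa [pwW_length] using h1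
    have hu : 0 < u.length := by
      rcases Nat.eq_zero_or_pos u.length with h | h
      · simp [h] at h3
      · exact h
    rw [List.getElem_rotate, pwW_getElem _ _ _ _ (Nat.mod_lt _ hu),
      pwW_getElem _ _ _ _ (by simpa using Nat.mod_lt _ hu), List.getElem_rotate]
    congr 1
    simp [pwW_length]

/-- Number of rotations fixing a word. -/
noncomputable def rotN (w : List α) : ℕ :=
  ((Finset.range w.length).filter fun i => w.rotate i = w).card

lemma rotN_rotate (w : List α) (k : ℕ) : rotN (w.rotate k) = rotN w := by
  unfold rotN
  rw [List.length_rotate]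
  congr 1
  apply Finset.filter_congr
  intro i _
  rw [List.rotate_rotate, add_comm, ← List.rotate_rotate, List.rotate_eq_rotate]

lemma rotN_isRotated {w w' : List α} (h : w.IsRotated w') : rotN w = rotN w' := by
  obtain ⟨k, rfl⟩ := h
  exact (rotN_rotate w k).symm

lemma rot_reverse_fix (w : List α) (i : ℕ) (h : w.reverse.rotate i = w.reverse) :
    w.rotate i = w := by
  rw [List.rotate_reverse] at h
  have h2 := List.reverse_injective h
  rcases Nat.eq_zero_or_pos w.length with h0 | h0
  · rw [List.length_eq_zero_iff] at h0; simp [h0]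
  have h3 : (w.rotate (w.length - i % w.length)).rotate (i % w.length) = w.rotate (i % w.length) := by
    rw [h2]
  rw [List.rotate_rotate, Nat.sub_add_cancel (Nat.mod_lt _ h0).le, List.rotate_length,
    List.rotate_mod] at h3
  exact h3.symm

lemma rotN_reverse (w : List α) : rotN w.reverse = rotN w := by
  unfold rotN
  rw [List.length_reverse]
  congr 1
  apply Finset.filter_congr
  intro i _
  refine ⟨rot_reverse_fix w i, fun h => ?_⟩
  apply rot_reverse_fix
  simpa using h

lemma rotN_map {β : Type*} (f : α → β) (hf : Function.Injective f) (w : List α) :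
    rotN (w.map f) = rotN w := by
  unfold rotN
  rw [List.length_map]
  congr 1
  apply Finset.filter_congr
  intro i _
  rw [← List.map_rotate]
  exact ⟨fun h => List.map_injective_iff.2 hf h, fun h => by rw [h]⟩

lemma rot_fix_mul (w : List α) (k : ℕ) (h : w.rotate k = w) (t : ℕ) : w.rotate (k * t) = w := by
  induction t with
  | zero => simp
  | succ t ih => rw [Nat.mul_succ, ← List.rotate_rotate, ih, h]

lemma rot_fix_dvd (u : List α) (hc : PrimitiveWord u) (r : ℕ) (hr : 0 < r) (i : ℕ)
    (h : (pwW u r).rotate i = pwW u r) : u.length ∣ i := by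
  have hd0 : 0 < u.length := List.length_pos_of_ne_nil hc.1
  have hd : (pwW u r).rotate u.length = pwW u r := by
    rw [pwW_rotate, List.rotate_length]
  by_contra hnd
  set g := Nat.gcd i u.length with hg
  have hgpos : 0 < g := Nat.gcd_pos_of_pos_right _ hd0
  have hgd : g ∣ u.length := Nat.gcd_dvd_right _ _
  have hgne : g ≠ u.length := fun e => hnd (e ▸ Nat.gcd_dvd_left i u.length)
  have hlt : g < u.length := lt_of_le_of_ne (Nat.le_of_dvd hd0 hgd) hgne
  obtain ⟨m, -, hm⟩ := Nat.exists_mul_mod_eq_gcd (n := i) (k := u.length) hlt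
  have hrg : (pwW u r).rotate g = pwW u r := by
    have h1 := rot_fix_mul _ _ h m
    have h2 : i * m = u.length * (i * m / u.length) + g := by
      have := Nat.div_add_mod (i * m) u.length
      rw [hm] at this; exact this.symm
    rw [h2, ← List.rotate_rotate, rot_fix_mul _ _ hd] at h1
    exact h1
  have hcg : u.rotate g = u := by
    rw [pwW_rotate] at hrg
    obtain ⟨r, rfl⟩ : ∃ r', r = r' + 1 := ⟨r - 1, by omega⟩
    rw [pwW_succ, pwW_succ] at hrg
    exact (List.append_inj hrg (by simp)).1
  have hstep : ∀ j (hj : j < u.length), u[j] = u[j % g]'(lt_of_le_of_lt (Nat.mod_le _ _) hj) := by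
    intro j
    induction j using Nat.strong_induction_on with
    | _ j ih =>
      intro hj
      rcases Nat.lt_or_ge j g with hjg | hjg
      · simp [Nat.mod_eq_of_lt hjg]
      · have h1 := ih (j - g) (by omega) (by omega)
        have h2 : (u.rotate g)[j - g]'(by simp; omega) = u[j - g] := by simp only [hcg]
        rw [List.getElem_rotate] at h2
        have h3 : (j - g + g) % u.length = j := by
          rw [Nat.sub_add_cancel hjg, Nat.mod_eq_of_lt hj]
        simp only [h3] at h2
        rw [h2, h1]
        simp only [(Nat.mod_eq_sub_mod hjg).symm]
  obtain ⟨t, ht⟩ := hgd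
  refine hc.2 (u.take g) t ?_ ?_
  · by_contra hlt2
    interval_cases t <;> omega
  · change u = pwW _ _
    have hl : (u.take g).length = g := by simp; omega
    apply List.ext_getElem
    · rw [pwW_length, hl, ht, mul_comm]
    · intro j h1 h2
      rw [pwW_getElem _ _ _ _ (by rw [hl]; exact Nat.mod_lt _ hgpos), hstep j h1]
      simp [hl]

lemma rotN_pwW (c : List α) (hc : PrimitiveWord c) (r : ℕ) (hr : 0 < r) : rotN (pwW c r) = r := by
  have hd0 : 0 < c.length := List.length_pos_of_ne_nil hc.1
  have : ((Finset.range (pwW c r).length).filter fun i => (pwW c r).rotate i = pwW c r) =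
      (Finset.range r).image (fun i => c.length * i) := by
    ext i
    simp only [Finset.mem_filter, Finset.mem_range, Finset.mem_image, pwW_length]
    constructor
    · rintro ⟨h1, h2⟩
      obtain ⟨t, rfl⟩ := rot_fix_dvd c hc r hr i h2
      refine ⟨t, ?_, rfl⟩
      rw [mul_comm r] at h1
      exact lt_of_mul_lt_mul_left h1 (Nat.zero_le _)
    · rintro ⟨t, h1, rfl⟩
      refine ⟨?_, ?_⟩
      · rw [mul_comm r]; exact Nat.mul_lt_mul_of_pos_left h1 hd0
      · apply rot_fix_mul; rw [pwW_rotate, List.rotate_length]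
  unfold rotN
  rw [this, Finset.card_image_of_injective _ (fun a b h => Nat.eq_of_mul_eq_mul_left hd0 h)]
  simp

lemma pwW_root {c c' : List α} {r : ℕ} (hr : 0 < r) (h : (pwW c r).IsRotated (pwW c' r)) :
    c.IsRotated c' := by
  obtain ⟨k, hk⟩ := h
  refine ⟨k, ?_⟩
  have hl : r * c.length = r * c'.length := by
    have := congrArg List.length hk
    simpa [pwW_length] using this
  rw [pwW_rotate] at hk
  obtain ⟨r, rfl⟩ : ∃ r', r = r' + 1 := ⟨r - 1, by omega⟩
  rw [pwW_succ, pwW_succ] at hk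
  exact (List.append_inj hk (by simpa using Nat.eq_of_mul_eq_mul_left hr hl)).1

end WordFacts

section WtpFacts

variable {s : ℕ}

/-- transposed letter -/
def flipL (p : Fin s × Bool) : Fin s × Bool := (p.1, !p.2)

lemma flipL_flipL (p : Fin s × Bool) : flipL (flipL p) = p := by simp [flipL]

lemma flipL_ne (p : Fin s × Bool) : flipL p ≠ p := by
  intro h
  have := congrArg Prod.snd h
  simp [flipL] at this

lemma flipL_inj : Function.Injective (flipL (s := s)) :=
  Function.LeftInverse.injective flipL_flipL

lemma wtp_eq (w : List (Fin s × Bool)) : wtp w = (w.map flipL).reverse := rfl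

lemma wtp_wtp (w : List (Fin s × Bool)) : wtp (wtp w) = w := by
  rw [wtp_eq, wtp_eq, List.map_reverse, List.reverse_reverse, List.map_map]
  have : flipL ∘ flipL (s := s) = id := funext flipL_flipL
  simp [this]

lemma wtp_isRotated {w w' : List (Fin s × Bool)} (h : w.IsRotated w') :
    (wtp w).IsRotated (wtp w') := by
  rw [wtp_eq, wtp_eq]; exact (h.map flipL).reverse

lemma rotN_wtp (w : List (Fin s × Bool)) : rotN (wtp w) = rotN w := by
  rw [wtp_eq, rotN_reverse, rotN_map _ flipL_inj]

lemma rotN_weqCT {w w' : List (Fin s × Bool)} (h : weqCT w w') : rotN w = rotN w' := by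
  rcases h with h | h
  · exact rotN_isRotated h
  · rw [rotN_isRotated h, rotN_wtp]

lemma weqT_symm {w w' : List (Fin s × Bool)} (h : weqT w w') : weqT w' w := by
  rcases h with h | h
  · exact Or.inl h.symm
  · right; rw [h, wtp_wtp]

lemma weqT_trans {w w' w'' : List (Fin s × Bool)} (h : weqT w w') (h' : weqT w' w'') :
    weqT w w'' := by
  rcases h with rfl | rfl
  · exact h'
  · rcases h' with rfl | rfl
    · exact Or.inr rfl
    · left; rw [wtp_wtp]

lemma weqCT_symm {w w' : List (Fin s × Bool)} (h : weqCT w w') : weqCT w' w := by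
  rcases h with h | h
  · exact Or.inl h.symm
  · right
    have := wtp_isRotated h
    rw [wtp_wtp] at this
    exact this.symm

lemma weqCT_trans {w w' w'' : List (Fin s × Bool)} (h : weqCT w w') (h' : weqCT w' w'') :
    weqCT w w'' := by
  rcases h with h | h
  · rcases h' with h' | h'
    · exact Or.inl (h.trans h')
    · exact Or.inr (h.trans h')
  · rcases h' with h' | h'
    · exact Or.inr (h.trans (wtp_isRotated h'))
    · left
      have := wtp_isRotated h'
      rw [wtp_wtp] at this
      exact h.trans this

lemma wtp_pwW (c : List (Fin s × Bool)) (r : ℕ) : wtp (pwW c r) = pwW (wtp c) r := by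
  induction r with
  | zero => simp [pwW, wtp]
  | succ r ih =>
    rw [pwW_succ, pwW_succ', ← ih]
    simp [wtp_eq]

lemma pw_unique {c c' : List (Fin s × Bool)} (hc : PrimitiveWord c) (hc' : PrimitiveWord c')
    {r r' : ℕ} (hr : 0 < r) (hr' : 0 < r') (h : weqCT (pwW c r) (pwW c' r')) :
    r = r' ∧ weqCT c c' := by
  have e : r = r' := by
    have := rotN_weqCT h
    rwa [rotN_pwW c hc r hr, rotN_pwW c' hc' r' hr'] at this
  subst e
  refine ⟨rfl, ?_⟩
  rcases h with h | h
  · exact Or.inl (pwW_root hr h)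
  · rw [wtp_pwW] at h
    exact Or.inr (pwW_root hr h)

end WtpFacts

/-! ### Counting isomorphisms -/

section Counting

variable {Γ : Type} [Group Γ] {X : Type} {Λ : Type} (lett : X → Λ)

/-- letter-preserving equivariant permutations -/
def IsoSet (Φ Ψ : Γ →* Equiv.Perm X) : Set (Equiv.Perm X) :=
  {g | (∀ γ x, g (Φ γ x) = Ψ γ (g x)) ∧ ∀ x, lett (g x) = lett x}

/-- pointed isomorphism of orbits -/
def PtIso (Φ Ψ : Γ →* Equiv.Perm X) (x y : X) : Prop :=
  ∀ γ, (Φ γ x = x ↔ Ψ γ y = y) ∧ lett (Φ γ x) = lett (Ψ γ y)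

/-- `h` is a transversal of the orbits -/
def Transv {A : Type} (Φ : Γ →* Equiv.Perm X) (h : A → X) : Prop :=
  ∀ x, ∃! a, ∃ γ, x = Φ γ (h a)

variable {lett}

lemma ptIso_eq_iff {Φ Ψ : Γ →* Equiv.Perm X} {x y : X} (h : PtIso lett Φ Ψ x y) (γ δ : Γ) :
    Φ γ x = Φ δ x ↔ Ψ γ y = Ψ δ y := by
  have := (h (δ⁻¹ * γ)).1
  simp only [map_mul, map_inv, Equiv.Perm.mul_apply, Equiv.Perm.inv_eq_iff_eq] at this
  exact this

variable [Fintype X] {A B : Type} [Fintype A] [Fintype B]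

/-- orbit count -/
noncomputable def orbCount (lett : X → Λ) (Φ Ψ : Γ →* Equiv.Perm X) (x y0 : X) : ℕ :=
  Fintype.card {y : X // (∃ γ, y = Ψ γ y0) ∧ PtIso lett Φ Ψ x y}

lemma iso_exists_equiv {Φ Ψ : Γ →* Equiv.Perm X} {h : A → X} {k : B → X}
    (hh : Transv Φ h) (hk : Transv Ψ k) {g : Equiv.Perm X} (hg : g ∈ IsoSet lett Φ Ψ) :
    ∃ e : A ≃ B, ∀ a, (∃ γ, g (h a) = Ψ γ (k (e a))) ∧ PtIso lett Φ Ψ (h a) (g (h a)) := by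
  choose f hf using fun a => (hk (g (h a))).exists
  have hgi : ∀ γ x, g⁻¹ (Ψ γ x) = Φ γ (g⁻¹ x) := by
    intro γ x
    rw [Equiv.Perm.inv_eq_iff_eq, hg.1]; simp
  have inj : Function.Injective f := by
    intro a a' haa
    obtain ⟨γ, hγ⟩ := hf a
    obtain ⟨δ, hδ⟩ := hf a'
    rw [haa] at hγ
    have h1 : g (h a) = Ψ (γ * δ⁻¹) (g (h a')) := by
      rw [hγ, hδ]; simp
    rw [← hg.1] at h1
    have h2 := g.injective h1
    exact (hh (h a)).unique ⟨1, by simp⟩ ⟨_, h2⟩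
  have surj : Function.Surjective f := by
    intro b
    obtain ⟨a, γ, hγ⟩ := (hh (g⁻¹ (k b))).exists
    refine ⟨a, ?_⟩
    obtain ⟨δ, hδ⟩ := hf a
    have h1 : k b = Ψ γ (g (h a)) := by rw [← hg.1, ← hγ]; simp
    exact (hk (k b)).unique ⟨γ * δ, by rw [h1, hδ]; simp⟩ ⟨1, by simp⟩
  refine ⟨Equiv.ofBijective f ⟨inj, surj⟩, fun a => ⟨hf a, fun γ => ⟨?_, ?_⟩⟩⟩
  · rw [← hg.1]; exact g.injective.eq_iff.symm
  · rw [← hg.1, hg.2]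

lemma iso_of_choice {Φ Ψ : Γ →* Equiv.Perm X} {h : A → X} {k : B → X}
    (hh : Transv Φ h) (hk : Transv Ψ k) (e : A ≃ B) (F : A → X)
    (hF : ∀ a, (∃ γ, F a = Ψ γ (k (e a))) ∧ PtIso lett Φ Ψ (h a) (F a)) :
    ∃ g ∈ IsoSet lett Φ Ψ, ∀ a, g (h a) = F a := by
  choose fa fγ hfa using fun x => (hh x).exists
  have key : ∀ γ a, Ψ (fγ (Φ γ (h a))) (F (fa (Φ γ (h a)))) = Ψ γ (F a) := by
    intro γ a
    have e1 : fa (Φ γ (h a)) = a :=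
      (hh (Φ γ (h a))).unique ⟨_, hfa _⟩ ⟨γ, rfl⟩
    have e2 := hfa (Φ γ (h a))
    rw [e1] at e2 ⊢
    exact ((ptIso_eq_iff (hF a).2 _ _).1 e2).symm
  let g0 : X → X := fun x => Ψ (fγ x) (F (fa x))
  have hg0 : ∀ γ a, g0 (Φ γ (h a)) = Ψ γ (F a) := key
  have inj : Function.Injective g0 := by
    intro x x' hx
    obtain ⟨a, γ, rfl⟩ := (hh x).exists
    obtain ⟨a', γ', rfl⟩ := (hh x').exists
    rw [hg0, hg0] at hx
    obtain ⟨δ, hδ⟩ := (hF a).1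
    obtain ⟨δ', hδ'⟩ := (hF a').1
    have : e a = e a' := by
      refine (hk (Ψ γ (F a))).unique ⟨γ * δ, by rw [hδ]; simp⟩ ⟨γ' * δ', by rw [hx, hδ']; simp⟩
    have := e.injective this
    subst this
    exact (ptIso_eq_iff (hF a).2 _ _).2 hx
  refine ⟨Equiv.ofBijective g0 (Finite.injective_iff_bijective.1 inj), ⟨?_, ?_⟩, ?_⟩
  · intro γ x
    obtain ⟨a, δ, rfl⟩ := (hh x).exists
    simp only [Equiv.ofBijective_apply]
    rw [← Equiv.Perm.mul_apply, ← map_mul, hg0, hg0]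
    simp
  · intro x
    obtain ⟨a, δ, rfl⟩ := (hh x).exists
    simp only [Equiv.ofBijective_apply]
    rw [hg0]
    exact ((hF a).2 δ).2.symm
  · intro a
    have := hg0 1 a
    simpa using this

theorem card_iso {Φ Ψ : Γ →* Equiv.Perm X} {h : A → X} {k : B → X}
    (hh : Transv Φ h) (hk : Transv Ψ k) :
    Fintype.card (IsoSet lett Φ Ψ) = ∑ e : A ≃ B, ∏ a, orbCount lett Φ Ψ (h a) (k (e a)) := by
  let J := Σ e : A ≃ B, ∀ a, {y : X // (∃ γ, y = Ψ γ (k (e a))) ∧ PtIso lett Φ Ψ (h a) y}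
  have hJ : Fintype.card J = ∑ e : A ≃ B, ∏ a, orbCount lett Φ Ψ (h a) (k (e a)) := by
    simp only [J, Fintype.card_sigma, Fintype.card_pi, orbCount]
  rw [← hJ]
  let f1 : IsoSet lett Φ Ψ → (A → X) := fun g a => g.1 (h a)
  let f2 : J → (A → X) := fun j a => (j.2 a).1
  have i1 : Function.Injective f1 := by
    rintro ⟨g, hg⟩ ⟨g', hg'⟩ he
    apply Subtype.ext
    apply Equiv.ext
    intro x
    obtain ⟨a, γ, rfl⟩ := (hh x).exists
    have := congrFun he a
    simp only [f1] at this
    rw [hg.1, hg'.1, this]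
  have i2 : Function.Injective f2 := by
    rintro ⟨e, y⟩ ⟨e', y'⟩ he
    have hee : e = e' := by
      apply Equiv.ext
      intro a
      have h1 := (y a).2.1
      have h2 := (y' a).2.1
      have h3 : (y a).1 = (y' a).1 := congrFun he a
      rw [← h3] at h2
      exact (hk _).unique h1 h2
    subst hee
    congr 1
    funext a
    exact Subtype.ext (congrFun he a)
  have hr : Set.range f1 = Set.range f2 := by
    ext F
    constructor
    · rintro ⟨⟨g, hg⟩, rfl⟩
      obtain ⟨e, he⟩ := iso_exists_equiv hh hk hg
      exact ⟨⟨e, fun a => ⟨g (h a), he a⟩⟩, rfl⟩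
    · rintro ⟨⟨e, y⟩, rfl⟩
      obtain ⟨g, hg, hga⟩ := iso_of_choice hh hk e (fun a => (y a).1) (fun a => (y a).2)
      exact ⟨⟨g, hg⟩, funext hga⟩
  have c1 := Nat.card_congr (Equiv.ofInjective f1 i1)
  have c2 := Nat.card_congr (Equiv.ofInjective f2 i2)
  rw [← Nat.card_eq_fintype_card, ← Nat.card_eq_fintype_card, c1, c2, hr]

lemma exists_equiv_of_map_eq {Ω : Type} (tA : A → Ω) (tB : B → Ω)
    (h : (Finset.univ : Finset A).val.map tA = (Finset.univ : Finset B).val.map tB) :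
    ∃ e : A ≃ B, ∀ a, tB (e a) = tA a := by
  have hc : ∀ ω, Fintype.card {a // tA a = ω} = Fintype.card {b // tB b = ω} := by
    intro ω
    have := congrArg (Multiset.count ω) h
    rw [Multiset.count_map, Multiset.count_map] at this
    rw [Fintype.card_subtype, Fintype.card_subtype]
    simpa [Finset.card_def, Finset.filter_val, eq_comm] using this
  let e : A ≃ B := (Equiv.sigmaFiberEquiv tA).symm.trans
    ((Equiv.sigmaCongrRight fun ω => Fintype.equivOfCardEq (hc ω)).trans (Equiv.sigmaFiberEquiv tB))
  refine ⟨e, fun a => ?_⟩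
  exact ((Fintype.equivOfCardEq (hc (tA a))) ⟨a, rfl⟩).2

lemma card_type_equiv {Ω : Type} (tA : A → Ω) (tB : B → Ω) (N : Multiset Ω)
    (h : (Finset.univ : Finset A).val.map tA = N) (h' : (Finset.univ : Finset B).val.map tB = N) :
    ((Finset.univ : Finset (A ≃ B)).filter fun e => ∀ a, tA a = tB (e a)).card =
      ∏ ω ∈ N.toFinset, (N.count ω).factorial := by
  obtain ⟨e0, he0⟩ := exists_equiv_of_map_eq tA tB (h.trans h'.symm)
  have h1 := DomMulAct.stabilizer_card' tA
  have h2 : Fintype.card {g : Equiv.Perm A // tA ∘ g = tA} =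
      Fintype.card {e : A ≃ B // ∀ a, tA a = tB (e a)} := by
    apply Fintype.card_congr
    refine Equiv.subtypeEquiv (Equiv.equivCongr (Equiv.refl A) e0) ?_
    intro g
    simp only [Equiv.equivCongr_apply_apply, Equiv.refl_symm, Equiv.refl_apply, he0, funext_iff,
      Function.comp]
    exact forall_congr' fun a => eq_comm
  rw [← Fintype.card_subtype, ← h2]
  have h3 : N.toFinset = Finset.univ.image tA := by
    rw [← h]; ext ω; simp
  rw [h3]
  refine Eq.trans ?_ (h1.trans ?_)
  · exact Fintype.card_congr (Equiv.refl _)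
  apply Finset.prod_congr
  · ext; simp
  intro ω _
  congr 1
  rw [← h, Multiset.count_map, Fintype.card_subtype]
  simp [Finset.card_def, Finset.filter_val, eq_comm]

theorem card_iso_types {Φ Ψ : Γ →* Equiv.Perm X} {h : A → X} {k : B → X}
    (hh : Transv Φ h) (hk : Transv Ψ k) {Ω : Type} (tA : A → Ω) (tB : B → Ω) (lam : Ω → ℕ)
    (hn : ∀ a b, orbCount lett Φ Ψ (h a) (k b) = if tA a = tB b then lam (tA a) else 0)
    (N : Multiset Ω)
    (h1 : (Finset.univ : Finset A).val.map tA = N)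
    (h2 : (Finset.univ : Finset B).val.map tB = N) :
    Fintype.card (IsoSet lett Φ Ψ) =
      (∏ ω ∈ N.toFinset, (N.count ω).factorial) * (N.map lam).prod := by
  rw [card_iso hh hk, ← card_type_equiv tA tB N h1 h2, Finset.card_eq_sum_ones,
    Finset.sum_mul, Finset.sum_filter]
  apply Finset.sum_congr rfl
  intro e _
  simp only [hn]
  split_ifs with hc
  · rw [Finset.prod_congr rfl (fun a _ => if_pos (hc a)), ← h1, Multiset.map_map, one_mul]
    rfl
  · push Not at hc
    obtain ⟨a, ha⟩ := hc
    exact Finset.prod_eq_zero (Finset.mem_univ a) (if_neg ha)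

end Counting

/-! ### Abstract paths -/

/-- arrows with mates and letters -/
structure AStr (s : ℕ) (X : Type) where
  mate : X → X
  lett : X → Fin s × Bool
  ls : Fin s × Bool → Option Bool
  mate_mate : ∀ x, mate (mate x) = x
  lett_mate : ∀ x, lett (mate x) = flipL (lett x)
  touch : ∀ x, ls (lett x) ≠ none ∨ ls (lett (mate x)) ≠ none

namespace AStr

variable {s : ℕ} {X : Type} (S : AStr s X)

/-- distinguished column of a cell -/
def side (x : X) : Option Bool := S.ls (S.lett x)

/-- gluing of the two distinguished columns -/
structure Kap where
  k : X → X
  kk : ∀ x, k (k x) = x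
  k_none : ∀ x, S.side x = none → k x = x
  k_some : ∀ x, S.side x ≠ none → S.side (k x) ≠ none ∧ S.side (k x) ≠ S.side x

variable {S}

/-- action of the free group generated by mate and gluing -/
def act (K : S.Kap) : FreeGroup Bool →* Equiv.Perm X :=
  FreeGroup.lift fun b => if b then Function.Involutive.toPerm S.mate S.mate_mate
    else Function.Involutive.toPerm K.k K.kk

lemma act_true (K : S.Kap) (x : X) : act K (FreeGroup.of true) x = S.mate x := by
  simp [act]; rfl

lemma act_false (K : S.Kap) (x : X) : act K (FreeGroup.of false) x = K.k x := by
  simp [act]; rfl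

lemma act_rel {K K' : S.Kap} {R : X → X → Prop}
    (hm : ∀ u v, R u v → R (S.mate u) (S.mate v)) (hk : ∀ u v, R u v → R (K.k u) (K'.k v))
    (γ : FreeGroup Bool) : ∀ x y, R x y → R (act K γ x) (act K' γ y) := by
  have hinv : ∀ (K : S.Kap) b, act K (FreeGroup.of b)⁻¹ = act K (FreeGroup.of b) := by
    intro K b
    rw [map_inv]
    ext x
    rw [Equiv.Perm.inv_eq_iff_eq]
    cases b
    · rw [act_false, act_false, K.kk]
    · rw [act_true, act_true, S.mate_mate]
  have hof : ∀ b x y, R x y → R (act K (FreeGroup.of b) x) (act K' (FreeGroup.of b) y) := by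
    intro b x y h
    cases b
    · rw [act_false, act_false]; exact hk _ _ h
    · rw [act_true, act_true]; exact hm _ _ h
  induction γ using FreeGroup.induction_on with
  | C1 => intro x y h; simpa using h
  | of b => exact hof b
  | inv_of b _ =>
    intro x y h
    have := hof b x y h
    rw [← hinv, ← hinv] at this
    exact this
  | mul a b ha hb =>
    intro x y h
    rw [map_mul, map_mul]
    exact ha _ _ (hb _ _ h)

lemma act_closed {K : S.Kap} {P : X → Prop}
    (hm : ∀ u, P u → P (S.mate u)) (hk : ∀ u, P u → P (K.k u))
    (γ : FreeGroup Bool) (x : X) (h : P x) : P (act K γ x) :=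
  act_rel (K := K) (K' := K) (R := fun u _ => P u) (fun u _ => hm u) (fun u _ => hk u) γ x x h

/-- partial isomorphisms -/
structure PartIso (K K' : S.Kap) (R : X → X → Prop) : Prop where
  m : ∀ u v, R u v → R (S.mate u) (S.mate v)
  k : ∀ u v, R u v → R (K.k u) (K'.k v)
  le : ∀ u v, R u v → S.lett u = S.lett v
  l : ∀ u v v', R u v → R u v' → v = v'
  r : ∀ u u' v, R u v → R u' v → u = u'

lemma ptIso_iff {K K' : S.Kap} {x y : X} :
    PtIso S.lett (act K) (act K') x y ↔ ∃ R, PartIso K K' R ∧ R x y := by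
  constructor
  · intro h
    refine ⟨fun u v => ∃ γ, u = act K γ x ∧ v = act K' γ y, ⟨?_, ?_, ?_, ?_, ?_⟩, ⟨1, by simp⟩⟩
    · rintro u v ⟨γ, rfl, rfl⟩
      exact ⟨FreeGroup.of true * γ, by simp [act_true], by simp [act_true]⟩
    · rintro u v ⟨γ, rfl, rfl⟩
      exact ⟨FreeGroup.of false * γ, by simp [act_false], by simp [act_false]⟩
    · rintro u v ⟨γ, rfl, rfl⟩
      exact (h γ).2
    · rintro u v v' ⟨γ, rfl, rfl⟩ ⟨δ, h1, rfl⟩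
      exact (ptIso_eq_iff h _ _).1 h1
    · rintro u u' v ⟨γ, rfl, rfl⟩ ⟨δ, rfl, h1⟩
      exact (ptIso_eq_iff h _ _).2 h1
  · rintro ⟨R, hR, hxy⟩ γ
    have := act_rel hR.m hR.k γ x y hxy
    refine ⟨⟨fun e => ?_, fun e => ?_⟩, hR.le _ _ this⟩
    · rw [e] at this; exact hR.l _ _ _ this hxy
    · rw [e] at this; exact hR.r _ _ _ this hxy

lemma PartIso.symm {K K' : S.Kap} {R : X → X → Prop} (h : PartIso K K' R) :
    PartIso K' K (fun u v => R v u) :=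
  ⟨fun u v => h.m v u, fun u v => h.k v u, fun u v hh => (h.le v u hh).symm,
    fun u v v' h1 h2 => h.r _ _ _ h1 h2, fun u u' v h1 h2 => h.l _ _ _ h1 h2⟩

lemma PartIso.trans {K K' K'' : S.Kap} {R R' : X → X → Prop} (h : PartIso K K' R)
    (h' : PartIso K' K'' R') : PartIso K K'' (fun u w => ∃ v, R u v ∧ R' v w) := by
  refine ⟨?_, ?_, ?_, ?_, ?_⟩
  · rintro u w ⟨v, h1, h2⟩; exact ⟨_, h.m _ _ h1, h'.m _ _ h2⟩
  · rintro u w ⟨v, h1, h2⟩; exact ⟨_, h.k _ _ h1, h'.k _ _ h2⟩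
  · rintro u w ⟨v, h1, h2⟩; exact (h.le _ _ h1).trans (h'.le _ _ h2)
  · rintro u w w' ⟨v, h1, h2⟩ ⟨v', h3, h4⟩
    obtain rfl := h.l _ _ _ h1 h3
    exact h'.l _ _ _ h2 h4
  · rintro u u' w ⟨v, h1, h2⟩ ⟨v', h3, h4⟩
    obtain rfl := h'.r _ _ _ h2 h4
    exact h.r _ _ _ h1 h3

lemma PartIso.eq (K : S.Kap) : PartIso K K (fun u v => u = v) := by
  refine ⟨?_, ?_, ?_, ?_, ?_⟩ <;> (intros; simp_all)

lemma PartIso.side {K K' : S.Kap} {R : X → X → Prop} (h : PartIso K K' R) {u v : X}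
    (huv : R u v) : S.side u = S.side v := by
  unfold AStr.side; rw [h.le _ _ huv]

/-- step along a path -/
def sg (K : S.Kap) (x : X) : X := K.k (S.mate x)

lemma mate_ne (x : X) : S.mate x ≠ x := by
  intro h
  have := S.lett_mate x
  rw [h] at this
  exact flipL_ne _ this.symm

lemma sg_mate_sg (K : S.Kap) (x : X) : sg K (S.mate (sg K x)) = S.mate x := by
  unfold sg; rw [S.mate_mate, K.kk]

lemma sg_inj (K : S.Kap) : Function.Injective (sg K) := by
  intro x y h
  unfold sg at h
  have h1 := congrArg K.k h
  rw [K.kk, K.kk] at h1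
  have h2 := congrArg S.mate h1
  rwa [S.mate_mate, S.mate_mate] at h2

lemma PartIso.iter {K K' : S.Kap} {R : X → X → Prop} (h : PartIso K K' R) {u v : X}
    (huv : R u v) (i : ℕ) : R ((sg K)^[i] u) ((sg K')^[i] v) := by
  induction i with
  | zero => exact huv
  | succ i ih =>
    rw [Function.iterate_succ_apply', Function.iterate_succ_apply']
    exact h.k _ _ (h.m _ _ ih)

lemma sg_iter_mate (K : S.Kap) (x : X) (k m : ℕ) (h : m ≤ k) :
    (sg K)^[m] (S.mate ((sg K)^[k] x)) = S.mate ((sg K)^[k - m] x) := by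
  induction m with
  | zero => rfl
  | succ m ih =>
    rw [Function.iterate_succ_apply', ih (by omega)]
    have : k - m = (k - (m + 1)) + 1 := by omega
    rw [this, Function.iterate_succ_apply', sg_mate_sg]

/-- there are no reflections -/
lemma no_reflection {K : S.Kap} {R : X → X → Prop} (h : PartIso K K R) (y : X) (k : ℕ)
    (hR : R y (S.mate ((sg K)^[k] y)))
    (hs : ∀ m < k, S.side (S.mate ((sg K)^[m] y)) ≠ none) : False := by
  rcases Nat.even_or_odd' k with ⟨m, hk | hk⟩
  · have h1 := h.iter hR m
    rw [sg_iter_mate _ _ _ _ (by omega), show k - m = m by omega] at h1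
    have h2 := h.le _ _ h1
    rw [S.lett_mate] at h2
    exact flipL_ne _ h2.symm
  · have h1 := h.iter hR m
    rw [sg_iter_mate _ _ _ _ (by omega), show k - m = m + 1 by omega,
      Function.iterate_succ_apply'] at h1
    have h2 := h.m _ _ h1
    rw [S.mate_mate] at h2
    have h3 := h.side h2
    exact (K.k_some _ (hs m (by omega))).2 h3.symm

/-- abstract paths: open (`o = true`) or closed -/
structure IsP (K : S.Kap) (o : Bool) (l : List X) : Prop where
  pos : 0 < l.length
  chain : ∀ i (h : i + 1 < l.length), S.side (S.mate l[i]) ≠ none ∧ l[i + 1] = sg K l[i]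
  nodup : l.Nodup
  op : o = true → S.side l[0] = none ∧ S.side (S.mate l[l.length - 1]) = none
  cl : o = false → S.side (S.mate l[l.length - 1]) ≠ none ∧ l[0] = sg K l[l.length - 1]

variable {K K' : S.Kap} {o : Bool} {l l' : List X}

lemma IsP.iter (h : IsP K o l) (i : ℕ) (hi : i < l.length) :
    l[i] = (sg K)^[i] (l[0]'h.pos) := by
  induction i with
  | zero => rfl
  | succ i ih => rw [(h.chain i hi).2, ih (by omega), Function.iterate_succ_apply']

/-- cells visited -/
def Sset (S : AStr s X) (l : List X) (x : X) : Prop := x ∈ l ∨ S.mate x ∈ l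

lemma Sset_mate {x : X} (h : Sset S l x) : Sset S l (S.mate x) := by
  rcases h with h | h
  · right; rwa [S.mate_mate]
  · exact Or.inl h

lemma k_side_ne {x : X} (h : S.side x ≠ none) : K.k x ≠ x := fun e =>
  (K.k_some x h).2 (by rw [e])

lemma IsP.disj_aux (h : IsP K o l) (d : ℕ) : ∀ i j (hij : i + d = j) (hj : j < l.length),
    l[i] = S.mate l[j] → False := by
  induction d using Nat.strong_induction_on with
  | _ d ih =>
    intro i j hij hj e
    match d, ih, hij with
    | 0, _, hij =>
      subst hij
      exact mate_ne _ e.symm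
    | 1, _, hij =>
      subst hij
      have h1 := h.chain i hj
      rw [h1.2] at e
      have h2 := congrArg S.mate e
      rw [S.mate_mate] at h2
      exact k_side_ne h1.1 h2.symm
    | d + 2, ih, hij =>
      have h1 := (h.chain i (by omega)).2
      have h2 := (h.chain (j - 1) (by omega)).2
      have e2 : j - 1 + 1 = j := by omega
      simp only [e2] at h2
      refine ih d (by omega) (i + 1) (j - 1) (by omega) (by omega) ?_
      rw [h1, e, h2, sg_mate_sg]

lemma IsP.disj (h : IsP K o l) {x : X} (hx : x ∈ l) : S.mate x ∉ l := by
  intro hx'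
  obtain ⟨i, hi, rfl⟩ := List.getElem_of_mem hx
  obtain ⟨j, hj, hij⟩ := List.getElem_of_mem hx'
  rcases le_total i j with hle | hle
  · exact h.disj_aux (j - i) i j (by omega) hj (by rw [hij, S.mate_mate])
  · exact h.disj_aux (i - j) j i (by omega) hi hij

lemma IsP.k_zero_op (h : IsP K true l) : K.k (l[0]'h.pos) = l[0]'h.pos := K.k_none _ (h.op rfl).1

lemma IsP.k_last_op (h : IsP K true l) :
    K.k (S.mate (l[l.length - 1]'(by have := h.pos; omega))) =
      S.mate (l[l.length - 1]'(by have := h.pos; omega)) := K.k_none _ (h.op rfl).2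

lemma IsP.k_succ (h : IsP K o l) (i : ℕ) (hi : i + 1 < l.length) :
    K.k l[i + 1] = S.mate l[i] := by
  rw [(h.chain i hi).2, sg, K.kk]

lemma IsP.k_zero_cl (h : IsP K false l) : K.k (l[0]'h.pos) =
    S.mate (l[l.length - 1]'(by have := h.pos; omega)) := by
  rw [(h.cl rfl).2, sg, K.kk]

lemma IsP.Sset_k (h : IsP K o l) {x : X} (hx : Sset S l x) : Sset S l (K.k x) := by
  have hpos := h.pos
  rcases hx with hx | hx
  · obtain ⟨i, hi, rfl⟩ := List.getElem_of_mem hx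
    rcases i with _ | i
    · cases o
      · right; rw [h.k_zero_cl, S.mate_mate]; exact List.getElem_mem _
      · left; rw [h.k_zero_op]; exact List.getElem_mem _
    · right; rw [h.k_succ, S.mate_mate]; exact List.getElem_mem _
  · obtain ⟨i, hi, hix⟩ := List.getElem_of_mem hx
    have hx' : x = S.mate l[i] := by rw [hix, S.mate_mate]
    subst hx'
    by_cases hl : i + 1 < l.length
    · left
      have := (h.chain i hl).2
      rw [sg] at this
      rw [← this]; exact List.getElem_mem _
    · obtain rfl : i = l.length - 1 := by omega
      cases o
      · left
        have := (h.cl rfl).2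
        rw [sg] at this
        rw [← this]; exact List.getElem_mem _
      · right; rw [h.k_last_op, S.mate_mate]; exact List.getElem_mem _

lemma IsP.orbit (h : IsP K o l) (y : X) :
    (∃ γ, y = act K γ (l[0]'h.pos)) ↔ Sset S l y := by
  constructor
  · rintro ⟨γ, rfl⟩
    exact act_closed (P := Sset S l) (fun u => Sset_mate) (fun u => h.Sset_k) γ _
      (Or.inl (List.getElem_mem _))
  · have key : ∀ i (hi : i < l.length), ∃ γ, l[i] = act K γ (l[0]'h.pos) := by
      intro i
      induction i with
      | zero => intro _; exact ⟨1, by simp⟩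
      | succ i ih =>
        intro hi
        obtain ⟨γ, hγ⟩ := ih (by omega)
        refine ⟨FreeGroup.of false * (FreeGroup.of true * γ), ?_⟩
        rw [(h.chain i hi).2, map_mul, map_mul, Equiv.Perm.mul_apply, Equiv.Perm.mul_apply,
          act_false, act_true, ← hγ, sg]
    rintro (hy | hy)
    · obtain ⟨i, hi, rfl⟩ := List.getElem_of_mem hy
      exact key i hi
    · obtain ⟨i, hi, hiy⟩ := List.getElem_of_mem hy
      obtain ⟨γ, hγ⟩ := key i hi
      refine ⟨FreeGroup.of true * γ, ?_⟩
      rw [map_mul, Equiv.Perm.mul_apply, act_true, ← hγ, hiy, S.mate_mate]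

/-- transposed path -/
def tpA (S : AStr s X) (l : List X) : List X := (l.map S.mate).reverse

lemma tpA_length : (tpA S l).length = l.length := by simp [tpA]

lemma tpA_getElem (i : ℕ) (h : i < (tpA S l).length) :
    (tpA S l)[i] = S.mate (l[l.length - 1 - i]'(by rw [tpA_length] at h; omega)) := by
  simp [tpA]

lemma mem_tpA {x : X} : x ∈ tpA S l ↔ S.mate x ∈ l := by
  simp only [tpA, List.mem_reverse, List.mem_map]
  constructor
  · rintro ⟨a, ha, rfl⟩; rwa [S.mate_mate]
  · intro h; exact ⟨_, h, S.mate_mate x⟩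

lemma tpA_map_lett : (tpA S l).map S.lett = wtp (l.map S.lett) := by
  simp [tpA, wtp_eq, List.map_reverse, Function.comp_def, S.lett_mate]

lemma mate_inj : Function.Injective S.mate := Function.LeftInverse.injective S.mate_mate

lemma IsP.cyc (h : IsP K false l) (i : ℕ) (hi : i < l.length) :
    S.side (S.mate l[i]) ≠ none ∧
      l[(i + 1) % l.length]'(Nat.mod_lt _ h.pos) = sg K l[i] := by
  by_cases hl : i + 1 < l.length
  · simpa only [Nat.mod_eq_of_lt hl] using h.chain i hl
  · obtain rfl : i = l.length - 1 := by omega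
    have : (l.length - 1 + 1) % l.length = 0 := by
      rw [Nat.sub_add_cancel h.pos, Nat.mod_self]
    simpa only [this] using h.cl rfl

lemma isP_of_cyc (hp : 0 < l.length) (hn : l.Nodup)
    (h : ∀ i (hi : i < l.length), S.side (S.mate l[i]) ≠ none ∧
      l[(i + 1) % l.length]'(Nat.mod_lt _ hp) = sg K l[i]) : IsP K false l := by
  refine ⟨hp, ?_, hn, by simp, fun _ => ?_⟩
  · intro i hi
    simpa only [Nat.mod_eq_of_lt hi] using h i (by omega)
  · have : (l.length - 1 + 1) % l.length = 0 := by
      rw [Nat.sub_add_cancel hp, Nat.mod_self]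
    simpa only [this] using h (l.length - 1) (by omega)

lemma IsP.rotate (h : IsP K false l) (k : ℕ) : IsP K false (l.rotate k) := by
  apply isP_of_cyc (by simpa using h.pos) (by simpa using h.nodup)
  intro i hi
  rw [List.getElem_rotate, List.getElem_rotate]
  have := h.cyc ((i + k) % l.length) (Nat.mod_lt _ h.pos)
  refine ⟨this.1, ?_⟩
  rw [← this.2]
  congr 1
  simp only [List.length_rotate, Nat.mod_add_mod]
  congr 1; omega

lemma IsP.tp (h : IsP K o l) : IsP K o (tpA S l) := by
  have hpos := h.pos
  have hrev : ∀ x y : X, S.side (S.mate x) ≠ none ∧ y = sg K x →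
      S.side (S.mate (S.mate y)) ≠ none ∧ S.mate x = sg K (S.mate y) := by
    rintro x y ⟨h1, rfl⟩
    rw [S.mate_mate]
    refine ⟨(K.k_some _ h1).1, ?_⟩
    rw [sg_mate_sg]
  refine ⟨by rwa [tpA_length], ?_, ?_, ?_, ?_⟩
  · intro i hi
    rw [tpA_length] at hi
    rw [tpA_getElem, tpA_getElem]
    have h1 := h.chain (l.length - 1 - (i + 1)) (by omega)
    have e : l.length - 1 - (i + 1) + 1 = l.length - 1 - i := by omega
    simp only [e] at h1
    exact hrev _ _ h1
  · exact List.nodup_reverse.2 (h.nodup.map mate_inj)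
  · rintro rfl
    rw [tpA_getElem, tpA_getElem]
    simp only [tpA_length, S.mate_mate, Nat.sub_self, Nat.sub_zero]
    exact ⟨(h.op rfl).2, (h.op rfl).1⟩
  · rintro rfl
    rw [tpA_getElem, tpA_getElem]
    simp only [tpA_length, Nat.sub_self, Nat.sub_zero]
    exact hrev _ _ (h.cl rfl)

lemma IsP.side_cl (h : IsP K false l) {x : X} (hx : Sset S l x) : S.side x ≠ none := by
  have h1 : ∀ x ∈ l, S.side x ≠ none ∧ S.side (S.mate x) ≠ none := by
    intro x hx
    obtain ⟨i, hi, rfl⟩ := List.getElem_of_mem hx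
    refine ⟨?_, (h.cyc i hi).1⟩
    rcases i with _ | i
    · have := h.cl rfl
      rw [this.2]; exact (K.k_some _ this.1).1
    · have := h.chain i hi
      rw [this.2]; exact (K.k_some _ this.1).1
  rcases hx with hx | hx
  · exact (h1 _ hx).1
  · have := (h1 _ hx).2
    rwa [S.mate_mate] at this

/-- equivalence of paths -/
def eqvP (S : AStr s X) (o : Bool) (l l' : List X) : Prop :=
  if o then l = l' ∨ l = tpA S l' else l.IsRotated l' ∨ l.IsRotated (tpA S l')

lemma tpA_tpA : tpA S (tpA S l) = l := by
  have : S.mate ∘ S.mate = id := funext S.mate_mate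
  simp [tpA, List.map_reverse, this]

lemma eqvP_refl : eqvP S o l l := by
  unfold eqvP; split_ifs
  · exact Or.inl rfl
  · exact Or.inl (List.IsRotated.refl l)

lemma Sset_tpA {x : X} : Sset S (tpA S l) x ↔ Sset S l x := by
  unfold Sset
  rw [mem_tpA, mem_tpA, S.mate_mate]; tauto

lemma Sset_rot {x : X} (h : l.IsRotated l') : Sset S l x ↔ Sset S l' x := by
  unfold Sset; rw [h.mem_iff, h.mem_iff]

lemma Sset_eqvP {x : X} (h : eqvP S o l l') : Sset S l x ↔ Sset S l' x := by
  unfold eqvP at h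
  split_ifs at h
  · rcases h with rfl | rfl
    · rfl
    · exact Sset_tpA
  · rcases h with h | h
    · exact Sset_rot h
    · exact (Sset_rot h).trans Sset_tpA

lemma IsP.head_op (h : IsP K true l) {x : X} (hx : Sset S l x) (hs : S.side x = none) :
    ∃ l', eqvP S true l' l ∧ IsP K true l' ∧ ∃ h : 0 < l'.length, l'[0] = x := by
  have key : ∀ l, IsP K true l → x ∈ l → ∃ h : 0 < l.length, l[0] = x := by
    intro l h hx
    refine ⟨h.pos, ?_⟩
    obtain ⟨i, hi, rfl⟩ := List.getElem_of_mem hx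
    rcases i with _ | i
    · rfl
    · exfalso
      have := h.chain i hi
      rw [this.2] at hs
      exact (K.k_some _ this.1).1 hs
  rcases hx with hx | hx
  · exact ⟨l, eqvP_refl, h, key l h hx⟩
  · exact ⟨tpA S l, Or.inr rfl, h.tp, key _ h.tp (mem_tpA.2 hx)⟩

lemma IsP.head_cl (h : IsP K false l) {x : X} (hx : Sset S l x) :
    ∃ l', eqvP S false l' l ∧ IsP K false l' ∧ ∃ h : 0 < l'.length, l'[0] = x := by
  have key : ∀ l, IsP K false l → x ∈ l → ∃ l', l'.IsRotated l ∧ IsP K false l' ∧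
      ∃ h : 0 < l'.length, l'[0] = x := by
    intro l h hx
    obtain ⟨i, hi, rfl⟩ := List.getElem_of_mem hx
    refine ⟨l.rotate i, List.IsRotated.symm ⟨i, rfl⟩, h.rotate i, (h.rotate i).pos, ?_⟩
    rw [List.getElem_rotate]
    simp [Nat.mod_eq_of_lt hi]
  rcases hx with hx | hx
  · obtain ⟨l', h1, h2⟩ := key l h hx
    exact ⟨l', Or.inl h1, h2⟩
  · obtain ⟨l', h1, h2⟩ := key _ h.tp (mem_tpA.2 hx)
    exact ⟨l', Or.inr h1, h2⟩

lemma det_le {R : X → X → Prop} (hR : PartIso K K' R) (h : IsP K o l)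
    (h' : IsP K' o l') (h0 : R (l[0]'h.pos) (l'[0]'(h'.pos))) : l'.length ≤ l.length := by
  by_contra hlt
  push Not at hlt
  have hpos := h.pos
  cases o
  · have h1 := hR.iter h0 l.length
    have h2 : (sg K)^[l.length] (l[0]'h.pos) = l[0]'h.pos := by
      obtain ⟨r, hr⟩ : ∃ r, l.length = r + 1 := ⟨l.length - 1, by omega⟩
      rw [hr, Function.iterate_succ_apply', ← h.iter r (by omega)]
      have := (h.cl rfl).2
      have e : l.length - 1 = r := by omega
      simp only [e] at this
      exact this.symm
    rw [h2, ← h'.iter _ hlt] at h1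
    have h3 := hR.l _ _ _ h1 h0
    have := (h'.nodup.getElem_inj_iff).1 h3
    omega
  · have h1 := hR.iter h0 (l.length - 1)
    rw [← h.iter _ (by omega), ← h'.iter _ (by omega)] at h1
    have h2 := hR.side (hR.m _ _ h1)
    rw [(h.op rfl).2] at h2
    exact (h'.chain (l.length - 1) (by omega)).1 h2.symm

lemma det {R : X → X → Prop} (hR : PartIso K K' R) (h : IsP K o l)
    (h' : IsP K' o l') (h0 : R (l[0]'h.pos) (l'[0]'(h'.pos))) : l.length = l'.length ∧
      ∀ i (hi : i < l.length) (hi' : i < l'.length), R l[i] l'[i] := by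
  refine ⟨le_antisymm (det_le hR.symm h' h h0) (det_le hR h h' h0), ?_⟩
  intro i hi hi'
  rw [h.iter, h'.iter]
  exact hR.iter h0 i

lemma det_word {R : X → X → Prop} (hR : PartIso K K' R) (h : IsP K o l)
    (h' : IsP K' o l') (h0 : R (l[0]'h.pos) (l'[0]'(h'.pos))) : l.map S.lett = l'.map S.lett := by
  obtain ⟨h1, h2⟩ := det hR h h' h0
  apply List.ext_getElem
  · simpa using h1
  · intro i hi hi'
    simp only [List.getElem_map]
    exact hR.le _ _ (h2 i _ _)

lemma det_eq (h : IsP K o l) (h' : IsP K o l') (h0 : l[0]'h.pos = l'[0]'(h'.pos)) : l = l' := by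
  obtain ⟨h1, h2⟩ := det (PartIso.eq K) h h' h0
  exact List.ext_getElem h1 h2

lemma exists_partIso (h : IsP K o l) (h' : IsP K' o l') (hw : l.map S.lett = l'.map S.lett) :
    ∃ R, PartIso K K' R ∧ R (l[0]'h.pos) (l'[0]'(h'.pos)) := by
  have hlen : l.length = l'.length := by simpa using congrArg List.length hw
  have hpos := h.pos
  have hpos' := h'.pos
  have hle : ∀ i (hi : i < l.length) (hi' : i < l'.length), S.lett l[i] = S.lett l'[i] := by
    intro i hi hi'
    have : (l.map S.lett)[i]'(by simpa) = (l'.map S.lett)[i]'(by simpa) := by simp only [hw]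
    simpa using this
  have inj : ∀ {K : S.Kap} {l : List X} (h : IsP K o l) i j (hi : i < l.length) (hj : j < l.length),
      l[i] = l[j] → i = j := fun h i j hi hj e => (h.nodup.getElem_inj_iff).1 e
  have dis : ∀ {K : S.Kap} {l : List X} (h : IsP K o l) i j (hi : i < l.length) (hj : j < l.length),
      l[i] ≠ S.mate l[j] := fun h i j hi hj e =>
        h.disj (List.getElem_mem hj) (e ▸ List.getElem_mem hi)
  refine ⟨fun u v => ∃ (i : ℕ) (hi : i < l.length) (hi' : i < l'.length),
    (u = l[i] ∧ v = l'[i]) ∨ (u = S.mate l[i] ∧ v = S.mate l'[i]), ⟨?_, ?_, ?_, ?_, ?_⟩,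
    ⟨0, h.pos, h'.pos, Or.inl ⟨rfl, rfl⟩⟩⟩
  · rintro u v ⟨i, hi, hi', ⟨rfl, rfl⟩ | ⟨rfl, rfl⟩⟩
    · exact ⟨i, hi, hi', Or.inr ⟨rfl, rfl⟩⟩
    · exact ⟨i, hi, hi', Or.inl ⟨S.mate_mate _, S.mate_mate _⟩⟩
  · rintro u v ⟨i, hi, hi', ⟨rfl, rfl⟩ | ⟨rfl, rfl⟩⟩
    · rcases i with _ | i
      · cases o
        · refine ⟨l.length - 1, by omega, by omega, Or.inr ⟨h.k_zero_cl, ?_⟩⟩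
          simp only [hlen]; exact h'.k_zero_cl
        · exact ⟨0, hi, hi', Or.inl ⟨h.k_zero_op, h'.k_zero_op⟩⟩
      · exact ⟨i, by omega, by omega, Or.inr ⟨h.k_succ i hi, h'.k_succ i hi'⟩⟩
    · by_cases hl : i + 1 < l.length
      · exact ⟨i + 1, hl, by omega, Or.inl ⟨(h.chain i hl).2.symm,
          (h'.chain i (by omega)).2.symm⟩⟩
      · obtain rfl : i = l.length - 1 := by omega
        cases o
        · refine ⟨0, h.pos, h'.pos, Or.inl ⟨(h.cl rfl).2.symm, ?_⟩⟩
          simp only [hlen]; exact (h'.cl rfl).2.symm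
        · refine ⟨l.length - 1, hi, hi', Or.inr ⟨h.k_last_op, ?_⟩⟩
          simp only [hlen]; exact h'.k_last_op
  · rintro u v ⟨i, hi, hi', ⟨rfl, rfl⟩ | ⟨rfl, rfl⟩⟩
    · exact hle i hi hi'
    · rw [S.lett_mate, S.lett_mate, hle i hi hi']
  · rintro u v v' ⟨i, hi, hi', ⟨rfl, rfl⟩ | ⟨rfl, rfl⟩⟩ ⟨j, hj, hj', ⟨e, rfl⟩ | ⟨e, rfl⟩⟩
    · obtain rfl := inj h _ _ _ _ e; rfl
    · exact absurd e (dis h _ _ _ _)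
    · exact absurd e.symm (dis h _ _ _ _)
    · obtain rfl := inj h _ _ _ _ (mate_inj e); rfl
  · rintro u u' v ⟨i, hi, hi', ⟨rfl, rfl⟩ | ⟨rfl, rfl⟩⟩ ⟨j, hj, hj', ⟨rfl, e⟩ | ⟨rfl, e⟩⟩
    · obtain rfl := inj h' _ _ _ _ e; rfl
    · exact absurd e (dis h' _ _ _ _)
    · exact absurd e.symm (dis h' _ _ _ _)
    · obtain rfl := inj h' _ _ _ _ (mate_inj e); rfl

end AStr

/-! ### Existence of paths, transversals, orbit counts -/

namespace AStr

variable {s : ℕ} {X : Type} {S : AStr s X} {K K' : S.Kap} {o o' : Bool} {l l' : List X}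

lemma range_iter_nodup (f : X → X) (z : X) (m : ℕ) (hm : m ≤ Function.minimalPeriod f z) :
    ((List.range m).map fun i => f^[i] z).Nodup := by
  refine List.Nodup.map_on ?_ List.nodup_range
  intro i hi j hj h
  rw [List.mem_range] at hi hj
  exact Function.iterate_injOn_Iio_minimalPeriod (Set.mem_Iio.2 (by omega))
    (Set.mem_Iio.2 (by omega)) h

lemma exists_open [Finite X] (K : S.Kap) (z : X) (hz : S.side z = none) :
    ∃ l, IsP K true l ∧ ∃ h : 0 < l.length, l[0] = z := by
  have hp := Function.minimalPeriod_pos_of_mem_periodicPts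
    ((sg_inj K).mem_periodicPts z)
  set p := Function.minimalPeriod (sg K) z with hpdef
  have hper : (sg K)^[p] z = z := Function.iterate_minimalPeriod
  have hlast : S.side (S.mate ((sg K)^[p - 1] z)) = none := by
    have h1 : sg K ((sg K)^[p - 1] z) = z := by
      rw [← Function.iterate_succ_apply' (sg K), Nat.succ_eq_add_one, Nat.sub_add_cancel hp, hper]
    unfold sg at h1 ⊢
    have h2 := congrArg K.k h1
    rw [K.kk, K.k_none _ hz] at h2
    rw [h2, hz]
  have hex : ∃ i, S.side (S.mate ((sg K)^[i] z)) = none := ⟨_, hlast⟩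
  set m := Nat.find hex with hmdef
  have hm1 : S.side (S.mate ((sg K)^[m] z)) = none := Nat.find_spec hex
  have hm2 : ∀ i < m, S.side (S.mate ((sg K)^[i] z)) ≠ none := fun i hi => Nat.find_min hex hi
  have hm3 : m ≤ p - 1 := Nat.find_min' hex hlast
  refine ⟨(List.range (m + 1)).map fun i => (sg K)^[i] z, ⟨by simp, ?_, ?_, ?_, by simp⟩,
    by simp, by simp⟩
  · intro i hi
    simp only [List.length_map, List.length_range] at hi
    simp only [List.getElem_map, List.getElem_range]
    exact ⟨hm2 i (by omega), Function.iterate_succ_apply' _ _ _⟩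
  · exact range_iter_nodup _ _ _ (by omega)
  · intro _
    simp only [List.getElem_map, List.getElem_range, List.length_map, List.length_range,
      Nat.add_sub_cancel]
    exact ⟨hz, hm1⟩

lemma exists_path [Finite X] (K : S.Kap) (x : X) : ∃ o l, IsP K o l ∧ Sset S l x := by
  by_cases hc : ∃ γ, S.side (act K γ x) = none
  · obtain ⟨γ, hγ⟩ := hc
    obtain ⟨l, hl, h0, h1⟩ := exists_open K _ hγ
    refine ⟨true, l, hl, (hl.orbit x).1 ⟨γ⁻¹, ?_⟩⟩
    rw [h1]; simp
  · push Not at hc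
    have hp := Function.minimalPeriod_pos_of_mem_periodicPts
      ((sg_inj K).mem_periodicPts x)
    set p := Function.minimalPeriod (sg K) x with hpdef
    have hper : (sg K)^[p] x = x := Function.iterate_minimalPeriod
    have hs : ∀ i, S.side (S.mate ((sg K)^[i] x)) ≠ none := by
      have : ∀ i, ∃ γ, (sg K)^[i] x = act K γ x := by
        intro i
        induction i with
        | zero => exact ⟨1, by simp⟩
        | succ i ih =>
          obtain ⟨γ, hγ⟩ := ih
          refine ⟨FreeGroup.of false * (FreeGroup.of true * γ), ?_⟩
          rw [Function.iterate_succ_apply', hγ, map_mul, map_mul, Equiv.Perm.mul_apply,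
            Equiv.Perm.mul_apply, act_false, act_true, sg]
      intro i
      obtain ⟨γ, hγ⟩ := this i
      have := hc (FreeGroup.of true * γ)
      rw [map_mul, Equiv.Perm.mul_apply, act_true, ← hγ] at this
      exact this
    refine ⟨false, (List.range p).map fun i => (sg K)^[i] x,
      ⟨by simpa using hp, ?_, range_iter_nodup _ _ _ le_rfl, by simp, ?_⟩, Or.inl ?_⟩
    · intro i hi
      simp only [List.getElem_map, List.getElem_range]
      exact ⟨hs i, Function.iterate_succ_apply' _ _ _⟩
    · intro _
      simp only [List.getElem_map, List.getElem_range, List.length_map, List.length_range]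
      refine ⟨hs _, ?_⟩
      rw [← Function.iterate_succ_apply' (sg K), Nat.succ_eq_add_one, Nat.sub_add_cancel hp, hper]; rfl
    · exact List.mem_map.2 ⟨0, List.mem_range.2 hp, rfl⟩

lemma Sset_head (h : IsP K o l) : Sset S l (l[0]'h.pos) := Or.inl (List.getElem_mem _)

lemma Sset_transfer (h : IsP K o l) (h' : IsP K o' l') {x y : X} (hx : Sset S l x)
    (hx' : Sset S l' x) (hy : Sset S l y) : Sset S l' y := by
  obtain ⟨γ, hγ⟩ := (h.orbit x).2 hx
  obtain ⟨δ, hδ⟩ := (h'.orbit x).2 hx'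
  obtain ⟨ε, hε⟩ := (h.orbit y).2 hy
  refine (h'.orbit y).1 ⟨ε * γ⁻¹ * δ, ?_⟩
  rw [map_mul, Equiv.Perm.mul_apply, ← hδ, hγ, hε]; simp

lemma eqvP_symm_op (h : eqvP S true l l') : eqvP S true l' l := by
  rcases h with rfl | rfl
  · exact Or.inl rfl
  · exact Or.inr tpA_tpA.symm

lemma path_unique (h : IsP K o l) (h' : IsP K o' l') {x : X} (hx : Sset S l x)
    (hx' : Sset S l' x) : o = o' ∧ eqvP S o l l' := by
  have hz := Sset_transfer h h' hx hx' (Sset_head h)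
  have hz' := Sset_transfer h' h hx' hx (Sset_head h')
  cases o <;> cases o'
  · obtain ⟨l'', h1, h2, h3, h4⟩ := h'.head_cl hz
    have := det_eq h h2 h4.symm
    exact ⟨rfl, this ▸ h1⟩
  · exact absurd (h'.op rfl).1 (h.side_cl hz')
  · exact absurd (h.op rfl).1 (h'.side_cl hz)
  · obtain ⟨l'', h1, h2, h3, h4⟩ := h'.head_op hz (h.op rfl).1
    have := det_eq h h2 h4.symm
    exact ⟨rfl, this ▸ h1⟩

/-- a system of representatives of paths -/
structure PSys (K : S.Kap) (A : Type) where
  p : A → List X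
  ty : A → Bool
  hp : ∀ a, IsP K (ty a) (p a)
  hu : ∀ o l, IsP K o l → ∃! a, ty a = o ∧ eqvP S o l (p a)

/-- base point -/
def PSys.pt {A : Type} (P : PSys K A) (a : A) : X := (P.p a)[0]'(P.hp a).pos

lemma PSys.transv [Finite X] {A : Type} (P : PSys K A) : Transv (act K) P.pt := by
  intro x
  obtain ⟨o, l, hl, hx⟩ := exists_path K x
  obtain ⟨a, ⟨ha1, ha2⟩, _⟩ := P.hu o l hl
  have hax : Sset S (P.p a) x := (Sset_eqvP ha2).1 hx
  refine ⟨a, ((P.hp a).orbit x).2 hax, ?_⟩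
  intro a' ha'
  have hax' := ((P.hp a').orbit x).1 ha'
  obtain ⟨h1, h2⟩ := path_unique (P.hp a) (P.hp a') hax hax'
  exact (P.hu _ _ (P.hp a)).unique ⟨h1.symm, h2⟩ ⟨rfl, eqvP_refl⟩

/-- word equivalence -/
def weq (o : Bool) (w w' : List (Fin s × Bool)) : Prop := if o then weqT w w' else weqCT w w'

lemma weq_of_eqvP (h : eqvP S o l l') : weq o (l.map S.lett) (l'.map S.lett) := by
  cases o
  · rcases h with h | h
    · exact Or.inl (h.map _)
    · right; rw [← tpA_map_lett]; exact h.map _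
  · rcases h with rfl | rfl
    · exact Or.inl rfl
    · right; rw [← tpA_map_lett]

lemma exists_eqvP (h : IsP K o l') {w : List (Fin s × Bool)} (hw : weq o w (l'.map S.lett)) :
    ∃ l, IsP K o l ∧ eqvP S o l l' ∧ l.map S.lett = w := by
  cases o
  · rcases hw with hw | hw
    · obtain ⟨k, hk⟩ := hw.symm
      exact ⟨l'.rotate k, h.rotate k, Or.inl (List.IsRotated.symm ⟨k, rfl⟩), by rw [List.map_rotate, hk]⟩
    · obtain ⟨k, hk⟩ := hw.symm
      rw [← tpA_map_lett] at hk
      exact ⟨(tpA S l').rotate k, h.tp.rotate k, Or.inr (List.IsRotated.symm ⟨k, rfl⟩),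
        by rw [List.map_rotate, hk]⟩
  · rcases hw with rfl | rfl
    · exact ⟨l', h, Or.inl rfl, rfl⟩
    · exact ⟨tpA S l', h.tp, Or.inr rfl, tpA_map_lett⟩

lemma ptIso_path (h : IsP K o l) (h' : IsP K' o' l') {y : X} (hy : Sset S l' y)
    (hp : PtIso S.lett (act K) (act K') (l[0]'h.pos) y) :
    o = o' ∧ ∃ l1, IsP K' o l1 ∧ eqvP S o l1 l' ∧ l.map S.lett = l1.map S.lett ∧
      ∃ h : 0 < l1.length, l1[0] = y := by
  obtain ⟨R, hR, hRy⟩ := ptIso_iff.1 hp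
  cases o <;> cases o'
  · refine ⟨rfl, ?_⟩
    obtain ⟨l1, h1, h2, h3, h4⟩ := h'.head_cl hy
    exact ⟨l1, h2, h1, det_word hR h h2 (by rw [h4]; exact hRy), h3, h4⟩
  · exfalso
    obtain ⟨γ, hγ⟩ := (h'.orbit y).2 hy
    have h1 := act_rel hR.m hR.k γ⁻¹ _ _ hRy
    have h2 := hR.side h1
    have h3 : act K' γ⁻¹ y = l'[0]'(h'.pos) := by rw [hγ]; simp
    rw [h3, (h'.op rfl).1] at h2
    exact h.side_cl ((h.orbit _).1 ⟨γ⁻¹, rfl⟩) h2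
  · exfalso
    have h2 := hR.side hRy
    rw [(h.op rfl).1] at h2
    exact h'.side_cl hy h2.symm
  · refine ⟨rfl, ?_⟩
    have hs := hR.side hRy
    rw [(h.op rfl).1] at hs
    obtain ⟨l1, h1, h2, h3, h4⟩ := h'.head_op hy hs.symm
    exact ⟨l1, h2, h1, det_word hR h h2 (by rw [h4]; exact hRy), h3, h4⟩

lemma ptIso_of_word (h : IsP K o l) (h' : IsP K' o l') (hw : l.map S.lett = l'.map S.lett) :
    PtIso S.lett (act K) (act K') (l[0]'h.pos) (l'[0]'(h'.pos)) :=
  ptIso_iff.2 (exists_partIso h h' hw)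

lemma ptIso_two {x y y' : X} (h : PtIso S.lett (act K) (act K') x y)
    (h' : PtIso S.lett (act K) (act K') x y') : ∃ R, PartIso K' K' R ∧ R y y' := by
  obtain ⟨R, hR, hy⟩ := ptIso_iff.1 h
  obtain ⟨R', hR', hy'⟩ := ptIso_iff.1 h'
  exact ⟨_, hR.symm.trans hR', _, hy, hy'⟩

lemma IsP.no_refl (h : IsP K o l) {R : X → X → Prop} (hR : PartIso K K R) (i : ℕ)
    (hi : i < l.length) (h0 : R (l[0]'h.pos) (S.mate l[i])) : False := by
  rw [h.iter i hi] at h0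
  refine no_reflection hR _ i h0 ?_
  intro m hm
  rw [← h.iter m (by omega)]
  exact (h.chain m (by omega)).1

variable [Fintype X]

lemma orbCount_paths (h : IsP K o l) (h' : IsP K' o' l') :
    orbCount S.lett (act K) (act K') (l[0]'h.pos) (l'[0]'(h'.pos)) =
      if o = o' ∧ weq o (l.map S.lett) (l'.map S.lett) then
        (if o then 1 else rotN (l.map S.lett)) else 0 := by
  unfold orbCount
  split_ifs with hc ho
  · obtain ⟨rfl, hw⟩ := hc
    subst ho
    obtain ⟨l1, g1, g2, g3⟩ := exists_eqvP h' hw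
    rw [Fintype.card_eq_one_iff]
    refine ⟨⟨l1[0]'g1.pos, (h'.orbit _).2 ((Sset_eqvP g2).1 (Sset_head g1)),
      ptIso_of_word h g1 g3.symm⟩, ?_⟩
    rintro ⟨y, hy, hp⟩
    apply Subtype.ext
    simp only
    obtain ⟨-, l2, f1, f2, f3, f4, f5⟩ := ptIso_path h h' ((h'.orbit y).1 hy) hp
    obtain ⟨R, hR, hRy⟩ := ptIso_two (ptIso_of_word h g1 g3.symm) hp
    have hcase : l2 = l1 ∨ l2 = tpA S l1 := by
      rcases g2 with rfl | rfl
      · exact f2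
      · rcases f2 with rfl | rfl
        · right; exact tpA_tpA.symm
        · exact Or.inl rfl
    rcases hcase with rfl | rfl
    · exact f5.symm
    · exfalso
      rw [tpA_getElem] at f5
      subst f5
      exact g1.no_refl hR _ _ hRy
  · obtain ⟨rfl, hw⟩ := hc
    have ho' : o = false := by simpa using ho
    subst ho'
    obtain ⟨l1, g1, g2, g3⟩ := exists_eqvP h' hw
    rw [Fintype.card_subtype, ← g3, rotN]
    symm
    refine Finset.card_bij (fun i hi => l1[i]'(by
      simp only [Finset.mem_filter, Finset.mem_range, List.length_map] at hi; exact hi.1)) ?_ ?_ ?_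
    · intro i hi
      simp only [Finset.mem_filter, Finset.mem_range, List.length_map] at hi
      simp only [Finset.mem_filter, Finset.mem_univ, true_and]
      refine ⟨(h'.orbit _).2 ((Sset_eqvP g2).1 (Or.inl (List.getElem_mem _))), ?_⟩
      have := ptIso_of_word h (g1.rotate i) (by rw [List.map_rotate, hi.2, g3])
      simpa [List.getElem_rotate, Nat.mod_eq_of_lt hi.1] using this
    · intro i hi j hj e
      exact (g1.nodup.getElem_inj_iff).1 e
    · intro y hy
      simp only [Finset.mem_filter, Finset.mem_univ, true_and] at hy
      obtain ⟨hy, hp⟩ := hy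
      have hy1 := (Sset_eqvP g2).2 ((h'.orbit y).1 hy)
      obtain ⟨R, hR, hRy⟩ := ptIso_two (ptIso_of_word h g1 g3.symm) hp
      rcases hy1 with hy1 | hy1
      · obtain ⟨i, hi, rfl⟩ := List.getElem_of_mem hy1
        refine ⟨i, ?_, rfl⟩
        simp only [Finset.mem_filter, Finset.mem_range, List.length_map]
        refine ⟨hi, ?_⟩
        have := det_word hR g1 (g1.rotate i)
          (by simpa [List.getElem_rotate, Nat.mod_eq_of_lt hi] using hRy)
        rw [← List.map_rotate, ← this]
      · exfalso
        obtain ⟨i, hi, hiy⟩ := List.getElem_of_mem hy1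
        have : y = S.mate l1[i] := by rw [hiy, S.mate_mate]
        subst this
        exact g1.no_refl hR _ _ hRy
  · rw [Fintype.card_eq_zero_iff]
    constructor
    rintro ⟨y, hy, hp⟩
    obtain ⟨rfl, l2, f1, f2, f3, f4, f5⟩ := ptIso_path h h' ((h'.orbit y).1 hy) hp
    refine hc ⟨rfl, ?_⟩
    rw [f3]
    exact weq_of_eqvP f2

end AStr

/-! ### Isomorphism counts in terms of words -/

namespace AStr

variable {s : ℕ} {X : Type} [Fintype X] {S : AStr s X} {K K' : S.Kap}
  {A B : Type} [Fintype A] [Fintype B]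

/-- word of a representative -/
def PSys.w (P : PSys K A) (a : A) : List (Fin s × Bool) := (P.p a).map S.lett

/-- multiset of words -/
noncomputable def PSys.W (P : PSys K A) (o : Bool) : Multiset (List (Fin s × Bool)) :=
  (Finset.univ.filter fun a => P.ty a = o).val.map P.w

lemma PSys.orbCount (P : PSys K A) (P' : PSys K' B) (a : A) (b : B) :
    orbCount S.lett (act K) (act K') (P.pt a) (P'.pt b) =
      if P.ty a = P'.ty b ∧ weq (P.ty a) (P.w a) (P'.w b) then
        (if P.ty a then 1 else rotN (P.w a)) else 0 :=
  orbCount_paths (P.hp a) (P'.hp b)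

lemma weq_symm {o : Bool} {w w' : List (Fin s × Bool)} (h : weq o w w') : weq o w' w := by
  cases o
  · exact weqCT_symm h
  · exact weqT_symm h

theorem PSys.iso_rel (P : PSys K A) (P' : PSys K' B)
    (hne : (IsoSet S.lett (act K) (act K')).Nonempty) (o : Bool) :
    Multiset.Rel (weq o) (P'.W o) (P.W o) := by
  obtain ⟨g, hg⟩ := hne
  obtain ⟨e, he⟩ := iso_exists_equiv P.transv P'.transv hg
  have key : ∀ a, P.ty a = P'.ty (e a) ∧ weq (P.ty a) (P.w a) (P'.w (e a)) := by
    intro a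
    by_contra hc
    have h1 := P.orbCount P' a (e a)
    rw [if_neg hc] at h1
    unfold _root_.orbCount at h1
    rw [Fintype.card_eq_zero_iff] at h1
    exact h1.elim ⟨_, he a⟩
  have hfil : (Finset.univ.filter fun b => P'.ty b = o) =
      (Finset.univ.filter fun a => P.ty a = o).map e.toEmbedding := by
    ext b
    simp only [Finset.mem_filter, Finset.mem_univ, true_and, Finset.mem_map,
      Equiv.coe_toEmbedding]
    constructor
    · intro hb
      exact ⟨e.symm b, by rw [(key _).1]; simpa using hb, by simp⟩
    · rintro ⟨a, ha, rfl⟩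
      rw [← (key _).1, ha]
  unfold PSys.W
  rw [hfil, Finset.map_val, Multiset.map_map, Multiset.rel_map]
  refine Multiset.rel_refl_of_refl_on ?_
  intro a ha
  have ha' : P.ty a = o := by simpa using ha
  have := weq_symm (key a).2
  rw [ha'] at this
  exact this

variable (Q : QuadData s) (L : Fin Q.q → Multiset ℕ)

/-- types of paths -/
abbrev Omg (Q : QuadData s) : Type := Fin Q.p ⊕ (Σ _ : Fin Q.q, ℕ)

/-- a path of given type -/
def HasTy (P : PSys K A) (Q : QuadData s) (a : A) : Omg Q → Prop
  | Sum.inl i => P.ty a = true ∧ weqT (P.w a) (Q.b i)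
  | Sum.inr x => P.ty a = false ∧ 0 < x.2 ∧ weqCT (P.w a) (pwW (Q.c x.1) x.2)

/-- multiset of types, open part -/
def NO (Q : QuadData s) : Multiset (Fin Q.p) := ∑ i, Multiset.replicate (Q.β i) i

/-- multiset of types, closed part -/
def NC (Q : QuadData s) (L : Fin Q.q → Multiset ℕ) : Multiset (Σ _ : Fin Q.q, ℕ) :=
  ∑ j, (L j).map fun r => ⟨j, r⟩

/-- multiset of types -/
def NN (Q : QuadData s) (L : Fin Q.q → Multiset ℕ) : Multiset (Omg Q) :=
  (NO Q).map Sum.inl + (NC Q L).map Sum.inr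

lemma NO_map : (NO Q).map Q.b = Q.mB := by
  unfold NO QuadData.mB
  rw [← Multiset.coe_mapAddMonoidHom, map_sum]
  simp

lemma NC_map : (NC Q L).map (fun x => pwW (Q.c x.1) x.2) =
    ∑ j, (L j).map fun lam => (List.replicate lam (Q.c j)).flatten := by
  unfold NC
  rw [← Multiset.coe_mapAddMonoidHom, map_sum]
  simp [Multiset.map_map, pwW]

lemma mem_NC {x : Σ _ : Fin Q.q, ℕ} (h : x ∈ NC Q L) : x.2 ∈ L x.1 := by
  unfold NC at h
  rw [Multiset.mem_sum] at h
  obtain ⟨j, -, hj⟩ := h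
  obtain ⟨r, hr, rfl⟩ := Multiset.mem_map.1 hj
  exact hr

lemma hasTy_unique (P : PSys K A) (hQ : Q.IsQuad) {a : A} {ω ω' : Omg Q}
    (h : HasTy P Q a ω) (h' : HasTy P Q a ω') : ω = ω' := by
  rcases ω with i | ⟨j, r⟩ <;> rcases ω' with i' | ⟨j', r'⟩
  · congr 1
    by_contra hne
    exact hQ.2.2.1 i i' hne (weqT_trans (weqT_symm h.2) h'.2)
  · exact absurd (h.1.symm.trans h'.1) (by simp)
  · exact absurd (h.1.symm.trans h'.1) (by simp)
  · obtain ⟨h1, h2⟩ := pw_unique (hQ.2.1 j) (hQ.2.1 j') h.2.1 h'.2.1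
      (weqCT_trans (weqCT_symm h.2.2) h'.2.2)
    obtain rfl : j = j' := by
      by_contra hne
      exact hQ.2.2.2 j j' hne h2
    simp only at h1
    subst h1
    rfl

lemma exists_ty (P : PSys K A) (hQ : Q.IsQuad) (hL : ∀ j, ∀ x ∈ L j, 0 < x)
    (h1 : Multiset.Rel weqT (P.W true) Q.mB)
    (h2 : Multiset.Rel weqCT (P.W false)
      (∑ j, (L j).map fun lam => (List.replicate lam (Q.c j)).flatten)) :
    ∃ t : A → Omg Q, (∀ a, HasTy P Q a (t a)) ∧ (Finset.univ : Finset A).val.map t = NN Q L := by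
  have hrel : Multiset.Rel (HasTy P Q) (Finset.univ : Finset A).val (NN Q L) := by
    have hsplit : (Finset.univ : Finset A).val =
        (Finset.univ.filter fun a => P.ty a = true).val +
        (Finset.univ.filter fun a => P.ty a = false).val := by
      rw [Finset.filter_val, Finset.filter_val]
      have := Multiset.filter_add_not (fun a => P.ty a = true) (Finset.univ : Finset A).val
      simp only [Bool.not_eq_true] at this
      exact this.symm
    rw [hsplit]
    apply Multiset.Rel.add
    · rw [← NO_map, PSys.W, Multiset.rel_map] at h1
      rw [Multiset.rel_map_right]
      refine h1.mono ?_
      intro a ha i hi hw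
      exact ⟨by simpa using ha, hw⟩
    · rw [← NC_map, PSys.W, Multiset.rel_map] at h2
      rw [Multiset.rel_map_right]
      refine h2.mono ?_
      intro a ha x hx hw
      exact ⟨by simpa using ha, hL _ _ (mem_NC Q L hx), hw⟩
  have hex : ∀ a, ∃ ω, HasTy P Q a ω := by
    intro a
    obtain ⟨ω, _, h⟩ := Multiset.exists_mem_of_rel_of_mem hrel (Finset.mem_univ_val a)
    exact ⟨ω, h⟩
  choose t ht using hex
  refine ⟨t, ht, ?_⟩
  rw [← Multiset.rel_eq, Multiset.rel_map_left]
  refine hrel.mono ?_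
  intro a _ ω _ h
  exact hasTy_unique Q P hQ (ht a) h

lemma count_inl (i : Fin Q.p) : (NN Q L).count (Sum.inl i) = Q.β i := by
  unfold NN
  rw [Multiset.count_add, Multiset.count_map_eq_count' _ _ Sum.inl_injective,
    Multiset.count_eq_zero.2 (show Sum.inl i ∉ (NC Q L).map Sum.inr by simp), add_zero, NO, Multiset.count_sum']
  simp [Multiset.count_replicate]

lemma count_inr (j : Fin Q.q) (r : ℕ) : (NN Q L).count (Sum.inr ⟨j, r⟩) = (L j).count r := by
  unfold NN
  rw [Multiset.count_add, Multiset.count_map_eq_count' _ _ Sum.inr_injective,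
    Multiset.count_eq_zero.2 (by simp), zero_add, NC, Multiset.count_sum']
  rw [Finset.sum_eq_single j]
  · exact Multiset.count_map_eq_count' _ _ sigma_mk_injective _
  · intro j' _ hne
    rw [Multiset.count_eq_zero, Multiset.mem_map]
    rintro ⟨x, _, hx⟩
    exact hne (congrArg Sigma.fst hx)
  · simp

/-- symmetry factor -/
def lamT : Omg Q → ℕ
  | Sum.inl _ => 1
  | Sum.inr x => x.2

lemma prod_NN :
    (∏ ω ∈ (NN Q L).toFinset, ((NN Q L).count ω).factorial) * ((NN Q L).map (lamT Q)).prod =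
      (∏ i : Fin Q.p, (Q.β i).factorial) * ∏ j : Fin Q.q, cPart (L j) := by
  have h1 : (∏ ω ∈ (NN Q L).toFinset, ((NN Q L).count ω).factorial) =
      (∏ i : Fin Q.p, (Q.β i).factorial) *
        ∏ j : Fin Q.q, ∏ r ∈ (L j).toFinset, ((L j).count r).factorial := by
    have hsub : (NN Q L).toFinset ⊆
        Finset.disjSum Finset.univ (Finset.univ.sigma fun j => (L j).toFinset) := by
      intro ω hω
      rw [Multiset.mem_toFinset] at hω
      rcases ω with i | ⟨j, r⟩
      · simp
      · have := Multiset.count_pos.2 hω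
        rw [count_inr] at this
        simpa using Multiset.count_pos.1 this
    rw [Finset.prod_subset hsub, Finset.prod_disjSum, Finset.prod_sigma]
    · simp only [count_inl, count_inr]
    · intro ω _ hω
      rw [Multiset.mem_toFinset] at hω
      rw [Multiset.count_eq_zero.2 hω, Nat.factorial_zero]
  have h2 : ((NN Q L).map (lamT Q)).prod = ∏ j, (L j).prod := by
    unfold NN
    rw [Multiset.map_add, Multiset.prod_add, Multiset.map_map, Multiset.map_map]
    have : (Multiset.map (lamT Q ∘ Sum.inl) (NO Q)).prod = 1 := by
      apply Multiset.prod_eq_one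
      intro x hx
      obtain ⟨i, _, rfl⟩ := Multiset.mem_map.1 hx
      rfl
    rw [this, one_mul, NC, ← Multiset.coe_mapAddMonoidHom, map_sum]
    have hprod : ∀ (t : Finset (Fin Q.q)) (f : Fin Q.q → Multiset ℕ),
        (∑ j ∈ t, f j).prod = ∏ j ∈ t, (f j).prod := by
      intro t f
      induction t using Finset.induction_on with
      | empty => simp
      | insert a t ha ih => rw [Finset.sum_insert ha, Finset.prod_insert ha, Multiset.prod_add, ih]
    rw [hprod]
    refine Finset.prod_congr rfl fun j _ => ?_
    simp only [Multiset.coe_mapAddMonoidHom, Multiset.map_map]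
    congr 1
    exact Multiset.map_id _
  rw [h1, h2, mul_assoc, ← Finset.prod_mul_distrib]
  congr 1
  refine Finset.prod_congr rfl fun j _ => ?_
  rw [cPart, mul_comm]

theorem PSys.iso_card (P : PSys K A) (P' : PSys K' B) (hQ : Q.IsQuad)
    (hL : ∀ j, ∀ x ∈ L j, 0 < x)
    (h1 : Multiset.Rel weqT (P.W true) Q.mB)
    (h2 : Multiset.Rel weqCT (P.W false)
      (∑ j, (L j).map fun lam => (List.replicate lam (Q.c j)).flatten))
    (h1' : Multiset.Rel weqT (P'.W true) Q.mB)
    (h2' : Multiset.Rel weqCT (P'.W false)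
      (∑ j, (L j).map fun lam => (List.replicate lam (Q.c j)).flatten)) :
    Fintype.card (IsoSet S.lett (act K) (act K')) =
      (∏ i : Fin Q.p, (Q.β i).factorial) * ∏ j : Fin Q.q, cPart (L j) := by
  obtain ⟨t, ht, htN⟩ := exists_ty Q L P hQ hL h1 h2
  obtain ⟨t', ht', htN'⟩ := exists_ty Q L P' hQ hL h1' h2'
  rw [← prod_NN]
  refine Eq.trans (card_iso_types P.transv P'.transv t t' (lamT Q) ?_ (NN Q L) htN htN')
    (by congr!)
  intro a b
  rw [P.orbCount P']
  have hiff : (P.ty a = P'.ty b ∧ weq (P.ty a) (P.w a) (P'.w b)) ↔ t a = t' b := by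
    have ha := ht a
    have hb := ht' b
    constructor
    · rintro ⟨hty, hw⟩
      refine hasTy_unique Q P hQ ha ?_
      rcases ht'b : t' b with i | x <;> rw [ht'b] at hb
      · rw [hty, hb.1] at hw
        exact ⟨hty.trans hb.1, weqT_trans hw hb.2⟩
      · rw [hty, hb.1] at hw
        exact ⟨hty.trans hb.1, hb.2.1, weqCT_trans hw hb.2.2⟩
    · intro e
      rw [← e] at hb
      rcases hta : t a with i | x <;> rw [hta] at ha hb
      · refine ⟨ha.1.trans hb.1.symm, ?_⟩
        rw [ha.1]
        exact weqT_trans ha.2 (weqT_symm hb.2)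
      · refine ⟨ha.1.trans hb.1.symm, ?_⟩
        rw [ha.1]
        exact weqCT_trans ha.2.2 (weqCT_symm hb.2.2)
  have hlam : (if P.ty a then 1 else rotN (P.w a)) = lamT Q (t a) := by
    have ha := ht a
    rcases hta : t a with i | x <;> rw [hta] at ha
    · rw [if_pos ha.1]; rfl
    · rw [if_neg (by rw [ha.1]; simp), rotN_weqCT ha.2.2, rotN_pwW _ (hQ.2.1 _) _ ha.2.1]; rfl
  rw [hlam]
  by_cases hc : t a = t' b
  · rw [if_pos (hiff.2 hc), if_pos hc]
  · rw [if_neg (fun h => hc (hiff.1 h)), if_neg hc]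

end AStr

/-! ### The concrete tableau -/

namespace TabSub

variable {A : Type} [CommRing A] {ι : Type} [Fintype ι] [DecidableEq ι] {n : ι → ℕ} {s : ℕ}

lemma colPerm_eq (q : ι) (π : Equiv.Perm (Fin (n q))) (j : Fin (n q)) :
    colPerm n q π ⟨q, j⟩ = ⟨q, π j⟩ := by
  simp [colPerm]

lemma colPerm_ne (q : ι) (π : Equiv.Perm (Fin (n q))) (i : ι) (hi : i ≠ q) (j : Fin (n i)) :
    colPerm n q π ⟨i, j⟩ = ⟨i, j⟩ := by
  simp [colPerm, hi]

lemma colPerm_fst (q : ι) (π : Equiv.Perm (Fin (n q))) (c : TabCell n) :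
    (colPerm n q π c).1 = c.1 := rfl

/-- column of a letter -/
def lcol (T : TabSub A ι n s) (p : Fin s × Bool) : ι := if p.2 then T.colHead p.1 else T.colTail p.1

lemma lcol_letter (T : TabSub A ι n s) (c : TabCell n) : T.lcol (T.letter c) = c.1 := by
  unfold lcol letter
  by_cases h : T.isTail c = true
  · simp [h, T.colTail_eq c h]
  · have h1 : T.isTail (T.mate c) = true := by rw [T.isTail_mate]; simpa using h
    have h2 := T.colHead_eq (T.mate c) h1
    rw [T.lab_mate, T.mate_invol] at h2
    simp [h, h2]

lemma letter_mate (T : TabSub A ι n s) (c : TabCell n) :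
    T.letter (T.mate c) = flipL (T.letter c) := by
  simp [letter, flipL, T.lab_mate, T.isTail_mate]

/-- a distinguished column -/
def Dist (q1 q2 i : ι) : Prop := i = q1 ∨ i = q2

/-- cells of arrows touching the distinguished columns -/
abbrev XT (T : TabSub A ι n s) (q1 q2 : ι) : Type :=
  {c : TabCell n // c.1 = q1 ∨ c.1 = q2 ∨ (T.mate c).1 = q1 ∨ (T.mate c).1 = q2}

/-- side of a column -/
def csd (q1 q2 i : ι) : Option Bool :=
  if i = q1 then some false else if i = q2 then some true else none

lemma csd_none {q1 q2 i : ι} : csd q1 q2 i = none ↔ i ≠ q1 ∧ i ≠ q2 := by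
  unfold csd; split_ifs <;> simp_all

lemma csd_ne_none {q1 q2 i : ι} : csd q1 q2 i ≠ none ↔ i = q1 ∨ i = q2 := by
  rw [ne_eq, csd_none]; tauto

/-- the abstract structure -/
def aS (T : TabSub A ι n s) (q1 q2 : ι) : AStr s (T.XT q1 q2) where
  mate x := ⟨T.mate x.1, by have := x.2; rw [T.mate_invol]; tauto⟩
  lett x := T.letter x.1
  ls p := csd q1 q2 (T.lcol p)
  mate_mate x := Subtype.ext (T.mate_invol _)
  lett_mate x := T.letter_mate _
  touch x := by
    rw [lcol_letter, lcol_letter, csd_ne_none, csd_ne_none]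
    have := x.2
    tauto

lemma aS_side (T : TabSub A ι n s) (q1 q2 : ι) (x : T.XT q1 q2) :
    (T.aS q1 q2).side x = csd q1 q2 x.1.1 := by
  unfold AStr.side aS
  simp only [lcol_letter]

/-- the gluing of the columns -/
def kc {q1 q2 : ι} (hn : n q1 = n q2) (π : Equiv.Perm (Fin (n q2))) (c : TabCell n) : TabCell n :=
  if h1 : c.1 = q1 then ⟨q2, π.symm (Fin.cast ((congrArg n h1).trans hn) c.2)⟩
  else if h2 : c.1 = q2 then ⟨q1, Fin.cast hn.symm (π (Fin.cast (congrArg n h2) c.2))⟩ else c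

lemma kc_q1 {q1 q2 : ι} (hn : n q1 = n q2) (π : Equiv.Perm (Fin (n q2))) (i : Fin (n q1)) :
    kc hn π ⟨q1, i⟩ = ⟨q2, π.symm (Fin.cast hn i)⟩ := by
  simp [kc]

lemma kc_q2 {q1 q2 : ι} (hq : q1 ≠ q2) (hn : n q1 = n q2) (π : Equiv.Perm (Fin (n q2)))
    (j : Fin (n q2)) : kc hn π ⟨q2, j⟩ = ⟨q1, Fin.cast hn.symm (π j)⟩ := by
  simp [kc, hq.symm]

lemma kc_ne {q1 q2 : ι} (hn : n q1 = n q2) (π : Equiv.Perm (Fin (n q2)))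
    (c : TabCell n) (h1 : c.1 ≠ q1) (h2 : c.1 ≠ q2) : kc hn π c = c := by
  simp [kc, h1, h2]

lemma cell_cases (q1 q2 : ι) (c : TabCell n) : (∃ i, c = ⟨q1, i⟩) ∨ (∃ j, c = ⟨q2, j⟩) ∨
    (c.1 ≠ q1 ∧ c.1 ≠ q2) := by
  obtain ⟨i, j⟩ := c
  by_cases h1 : i = q1
  · subst h1; exact Or.inl ⟨j, rfl⟩
  · by_cases h2 : i = q2
    · subst h2; exact Or.inr (Or.inl ⟨j, rfl⟩)
    · exact Or.inr (Or.inr ⟨h1, h2⟩)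

lemma kc_kc {q1 q2 : ι} (hq : q1 ≠ q2) (hn : n q1 = n q2) (π : Equiv.Perm (Fin (n q2)))
    (c : TabCell n) : kc hn π (kc hn π c) = c := by
  rcases cell_cases q1 q2 c with ⟨i, rfl⟩ | ⟨j, rfl⟩ | ⟨h1, h2⟩
  · rw [kc_q1, kc_q2 hq]; simp
  · rw [kc_q2 hq, kc_q1]; simp
  · rw [kc_ne hn π c h1 h2, kc_ne hn π c h1 h2]

lemma kc_dist {q1 q2 : ι} (hq : q1 ≠ q2) (hn : n q1 = n q2) (π : Equiv.Perm (Fin (n q2)))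
    (c : TabCell n) (h : c.1 = q1 ∨ c.1 = q2) :
    ((kc hn π c).1 = q1 ∨ (kc hn π c).1 = q2) ∧ csd q1 q2 (kc hn π c).1 ≠ csd q1 q2 c.1 := by
  rcases cell_cases q1 q2 c with ⟨i, rfl⟩ | ⟨j, rfl⟩ | ⟨h1, h2⟩
  · rw [kc_q1]; simp [csd, hq.symm]
  · rw [kc_q2 hq]; simp [csd, hq.symm]
  · tauto

/-- the gluing for `T^π` -/
def aK (T : TabSub A ι n s) {q1 q2 : ι} (hq : q1 ≠ q2) (hn : n q1 = n q2)
    (π : Equiv.Perm (Fin (n q2))) : (T.aS q1 q2).Kap where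
  k x := ⟨kc hn π x.1, by
    by_cases h : x.1.1 = q1 ∨ x.1.1 = q2
    · have := (kc_dist hq hn π x.1 h).1
      tauto
    · push Not at h
      rw [kc_ne hn π x.1 h.1 h.2]
      exact x.2⟩
  kk x := Subtype.ext (kc_kc hq hn π x.1)
  k_none x hx := by
    rw [aS_side, csd_none] at hx
    exact Subtype.ext (kc_ne hn π x.1 hx.1 hx.2)
  k_some x hx := by
    rw [aS_side, csd_ne_none] at hx
    rw [aS_side, aS_side, csd_ne_none]
    exact kc_dist hq hn π x.1 hx

lemma succ_iff (T : TabSub A ι n s) {q1 q2 : ι} (hq : q1 ≠ q2) (hn : n q1 = n q2)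
    (π : Equiv.Perm (Fin (n q2))) (c d : TabCell n) :
    (T.tw q2 π).Succ q1 q2 (colPerm n q2 π c) (colPerm n q2 π d) ↔
      ((T.mate c).1 = q1 ∨ (T.mate c).1 = q2) ∧ d = kc hn π (T.mate c) := by
  have hm : (T.tw q2 π).mate (colPerm n q2 π c) = colPerm n q2 π (T.mate c) := by
    simp [tw, permTab]
  unfold Succ
  rw [hm]
  generalize T.mate c = e
  rcases cell_cases q1 q2 e with ⟨i, rfl⟩ | ⟨j, rfl⟩ | ⟨h1, h2⟩
  · rw [kc_q1, colPerm_ne _ _ _ hq]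
    rcases cell_cases q1 q2 d with ⟨i', rfl⟩ | ⟨j', rfl⟩ | ⟨h1, h2⟩
    · rw [colPerm_ne _ _ _ hq]; simp [hq]
    · rw [colPerm_eq]
      simp only [true_or, or_true, true_and, ne_eq, hq, not_false_eq_true, Sigma.mk.injEq,
        heq_eq_eq, Equiv.eq_symm_apply]
      rw [Fin.ext_iff, Fin.val_cast, eq_comm]
    · constructor
      · rintro ⟨_, h, _⟩; rw [colPerm_fst] at h; tauto
      · rintro ⟨_, rfl⟩; exact absurd rfl h2
  · rw [kc_q2 hq, colPerm_eq]
    rcases cell_cases q1 q2 d with ⟨i', rfl⟩ | ⟨j', rfl⟩ | ⟨h1, h2⟩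
    · rw [colPerm_ne _ _ _ hq]
      simp only [true_or, or_true, true_and, ne_eq, hq.symm, not_false_eq_true, Sigma.mk.injEq,
        heq_eq_eq]
      rw [Fin.ext_iff, Fin.val_cast, eq_comm]
    · rw [colPerm_eq]; simp [hq.symm]
    · constructor
      · rintro ⟨_, h, _⟩; rw [colPerm_fst] at h; tauto
      · rintro ⟨_, rfl⟩; exact absurd rfl h1
  · have h3 : ¬ (e.1 = q1 ∨ e.1 = q2) := by tauto
    exact ⟨fun h => absurd h.1 h3, fun h => absurd h.1 h3⟩

/-- embedding of the abstract cells into `T^π` -/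
def emb (T : TabSub A ι n s) (q1 q2 : ι) (π : Equiv.Perm (Fin (n q2))) (x : T.XT q1 q2) :
    TabCell n := colPerm n q2 π x.1

lemma emb_inj (T : TabSub A ι n s) (q1 q2 : ι) (π : Equiv.Perm (Fin (n q2))) :
    Function.Injective (T.emb q1 q2 π) := by
  intro x y h
  exact Subtype.ext ((colPerm n q2 π).injective h)

lemma tw_mate_emb (T : TabSub A ι n s) (q1 q2 : ι) (π : Equiv.Perm (Fin (n q2)))
    (x : T.XT q1 q2) :
    (T.tw q2 π).mate (T.emb q1 q2 π x) = T.emb q1 q2 π ((T.aS q1 q2).mate x) := by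
  simp [tw, permTab, emb, aS]

lemma tw_letter_emb (T : TabSub A ι n s) (q1 q2 : ι) (π : Equiv.Perm (Fin (n q2)))
    (x : T.XT q1 q2) :
    (T.tw q2 π).letter (T.emb q1 q2 π x) = (T.aS q1 q2).lett x := by
  simp [tw, permTab, emb, aS, letter]

lemma tw_word_emb (T : TabSub A ι n s) (q1 q2 : ι) (π : Equiv.Perm (Fin (n q2)))
    (l : List (T.XT q1 q2)) :
    (T.tw q2 π).word (l.map (T.emb q1 q2 π)) = l.map (T.aS q1 q2).lett := by
  unfold word
  rw [List.map_map]
  exact List.map_congr_left fun x _ => T.tw_letter_emb q1 q2 π x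

lemma tw_tp_emb (T : TabSub A ι n s) (q1 q2 : ι) (π : Equiv.Perm (Fin (n q2)))
    (l : List (T.XT q1 q2)) :
    (T.tw q2 π).tp (l.map (T.emb q1 q2 π)) = (AStr.tpA (T.aS q1 q2) l).map (T.emb q1 q2 π) := by
  unfold tp AStr.tpA
  rw [List.map_reverse, List.map_map, List.map_map]
  congr 1
  exact List.map_congr_left fun x _ => T.tw_mate_emb q1 q2 π x

lemma isRotated_map_iff {α β : Type} {f : α → β} (hf : Function.Injective f) {l l' : List α} :
    (l.map f).IsRotated (l'.map f) ↔ l.IsRotated l' := by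
  constructor
  · rintro ⟨k, hk⟩
    rw [← List.map_rotate] at hk
    exact ⟨k, List.map_injective_iff.2 hf hk⟩
  · exact fun h => h.map f

lemma tw_eqT (T : TabSub A ι n s) (q1 q2 : ι) (π : Equiv.Perm (Fin (n q2)))
    (l l' : List (T.XT q1 q2)) :
    (T.tw q2 π).eqT (l.map (T.emb q1 q2 π)) (l'.map (T.emb q1 q2 π)) ↔
      AStr.eqvP (T.aS q1 q2) true l l' := by
  have hi := (List.map_injective_iff.2 (T.emb_inj q1 q2 π))
  unfold eqT AStr.eqvP
  rw [tw_tp_emb, hi.eq_iff, hi.eq_iff]; rfl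

lemma tw_eqCT (T : TabSub A ι n s) (q1 q2 : ι) (π : Equiv.Perm (Fin (n q2)))
    (l l' : List (T.XT q1 q2)) :
    (T.tw q2 π).eqCT (l.map (T.emb q1 q2 π)) (l'.map (T.emb q1 q2 π)) ↔
      AStr.eqvP (T.aS q1 q2) false l l' := by
  unfold eqCT AStr.eqvP
  rw [tw_tp_emb, isRotated_map_iff (T.emb_inj q1 q2 π), isRotated_map_iff (T.emb_inj q1 q2 π)]; rfl

lemma tw_succ_emb (T : TabSub A ι n s) {q1 q2 : ι} (hq : q1 ≠ q2) (hn : n q1 = n q2)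
    (π : Equiv.Perm (Fin (n q2))) (x y : T.XT q1 q2) :
    (T.tw q2 π).Succ q1 q2 (T.emb q1 q2 π x) (T.emb q1 q2 π y) ↔
      (T.aS q1 q2).side ((T.aS q1 q2).mate x) ≠ none ∧ y = AStr.sg (T.aK hq hn π) x := by
  unfold emb
  rw [succ_iff T hq hn, aS_side, csd_ne_none, Subtype.ext_iff]; rfl

lemma isPath_emb (T : TabSub A ι n s) {q1 q2 : ι} (hq : q1 ≠ q2) (hn : n q1 = n q2)
    (π : Equiv.Perm (Fin (n q2))) (l : List (T.XT q1 q2)) :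
    (T.tw q2 π).IsPath q1 q2 (l.map (T.emb q1 q2 π)) ↔
      0 < l.length ∧ (∀ i (h : i + 1 < l.length),
        (T.aS q1 q2).side ((T.aS q1 q2).mate l[i]) ≠ none ∧
          l[i + 1] = AStr.sg (T.aK hq hn π) l[i]) ∧ l.Nodup := by
  unfold IsPath
  rw [List.nodup_map_iff (T.emb_inj q1 q2 π), ← List.length_pos_iff, List.length_map]
  refine and_congr_right fun _ => and_congr_left fun _ => ?_
  change List.IsChain _ _ ↔ _
  rw [List.isChain_iff_getElem]
  simp only [List.length_map, List.getElem_map, tw_succ_emb T hq hn]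

lemma isClosed_emb (T : TabSub A ι n s) {q1 q2 : ι} (hq : q1 ≠ q2) (hn : n q1 = n q2)
    (π : Equiv.Perm (Fin (n q2))) (l : List (T.XT q1 q2)) :
    (T.tw q2 π).IsClosedPath q1 q2 (l.map (T.emb q1 q2 π)) ↔ AStr.IsP (T.aK hq hn π) false l := by
  unfold IsClosedPath
  rw [isPath_emb T hq hn]
  constructor
  · rintro ⟨⟨h1, h2, h3⟩, h4⟩
    refine ⟨h1, h2, h3, by simp, fun _ => ?_⟩
    have := h4 (by rw [← List.length_pos_iff, List.length_map]; exact h1)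
    rw [List.getLast_eq_getElem, List.head_eq_getElem, List.getElem_map, List.getElem_map,
      tw_succ_emb T hq hn] at this
    simpa only [List.length_map] using this
  · intro h
    refine ⟨⟨h.pos, h.chain, h.nodup⟩, fun h0 => ?_⟩
    rw [List.getLast_eq_getElem, List.head_eq_getElem, List.getElem_map, List.getElem_map,
      tw_succ_emb T hq hn]
    simpa only [List.length_map] using h.cl rfl

lemma isOpen_emb (T : TabSub A ι n s) {q1 q2 : ι} (hq : q1 ≠ q2) (hn : n q1 = n q2)
    (π : Equiv.Perm (Fin (n q2))) (l : List (T.XT q1 q2)) :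
    (T.tw q2 π).IsOpenPath q1 q2 (l.map (T.emb q1 q2 π)) ↔ AStr.IsP (T.aK hq hn π) true l := by
  unfold IsOpenPath
  rw [isPath_emb T hq hn]
  constructor
  · rintro ⟨⟨h1, h2, h3⟩, _, h4⟩
    refine ⟨h1, h2, h3, fun _ => ?_, by simp⟩
    have := h4 (by rw [← List.length_pos_iff, List.length_map]; exact h1)
    rw [List.getLast_eq_getElem, List.head_eq_getElem, List.getElem_map, List.getElem_map,
      tw_mate_emb] at this
    rw [aS_side, aS_side, csd_none, csd_none]
    simp only [List.length_map] at this
    exact this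
  · intro h
    have hop := h.op rfl
    refine ⟨⟨h.pos, h.chain, h.nodup⟩, ?_, fun h0 => ?_⟩
    · rw [List.length_map]
      by_contra hlt
      have hpos := h.pos
      have h1 : l.length - 1 = 0 := by omega
      simp only [h1] at hop
      rcases (T.aS q1 q2).touch (l[0]'hpos) with ht | ht
      · exact ht hop.1
      · exact ht hop.2
    · rw [List.getLast_eq_getElem, List.head_eq_getElem, List.getElem_map, List.getElem_map,
        tw_mate_emb]
      rw [aS_side, aS_side, csd_none, csd_none] at hop
      simp only [List.length_map]
      exact hop

lemma mem_range_emb (T : TabSub A ι n s) {q1 q2 : ι} 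
    (π : Equiv.Perm (Fin (n q2))) (c : TabCell n) (h : c.1 = q1 ∨ c.1 = q2 ∨
      ((T.tw q2 π).mate c).1 = q1 ∨ ((T.tw q2 π).mate c).1 = q2) :
    c ∈ Set.range (T.emb q1 q2 π) := by
  obtain ⟨d, rfl⟩ := (colPerm n q2 π).surjective c
  have hm : (T.tw q2 π).mate (colPerm n q2 π d) = colPerm n q2 π (T.mate d) := by
    simp [tw, permTab]
  rw [hm, colPerm_fst, colPerm_fst] at h
  exact ⟨⟨d, h⟩, rfl⟩

lemma open_lift (T : TabSub A ι n s) {q1 q2 : ι} (π : Equiv.Perm (Fin (n q2)))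
    (l : List (TabCell n)) (h : (T.tw q2 π).IsOpenPath q1 q2 l) :
    ∃ l' : List (T.XT q1 q2), l'.map (T.emb q1 q2 π) = l := by
  have : l ∈ Set.range (List.map (T.emb q1 q2 π)) := by
    rw [Set.range_list_map]
    intro c hc
    apply mem_range_emb
    obtain ⟨⟨_, h1, _⟩, h2, _⟩ := h
    replace h1 : List.IsChain _ _ := h1
    rw [List.isChain_iff_getElem] at h1
    obtain ⟨i, hi, rfl⟩ := List.getElem_of_mem hc
    by_cases hl : i + 1 < l.length
    · have := (h1 i hl).1
      tauto
    · obtain ⟨k, rfl⟩ : ∃ k, i = k + 1 := ⟨i - 1, by omega⟩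
      have := (h1 k hi).2.1
      tauto
  exact this

lemma closed_lift (T : TabSub A ι n s) {q1 q2 : ι} (π : Equiv.Perm (Fin (n q2)))
    (l : List (TabCell n)) (h : (T.tw q2 π).IsClosedPath q1 q2 l) :
    ∃ l' : List (T.XT q1 q2), l'.map (T.emb q1 q2 π) = l := by
  have : l ∈ Set.range (List.map (T.emb q1 q2 π)) := by
    rw [Set.range_list_map]
    intro c hc
    apply mem_range_emb
    obtain ⟨⟨h0, h1, _⟩, h2⟩ := h
    replace h1 : List.IsChain _ _ := h1
    rw [List.isChain_iff_getElem] at h1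
    obtain ⟨i, hi, rfl⟩ := List.getElem_of_mem hc
    by_cases hl : i + 1 < l.length
    · have := (h1 i hl).1
      tauto
    · have := (h2 h0).1
      rw [List.getLast_eq_getElem] at this
      have e : i = l.length - 1 := by omega
      subst e
      tauto
  exact this

end TabSub

/-! ### Counting automorphisms, and the final assembly -/

namespace AStr

variable {s : ℕ} {X : Type} (S : AStr s X)

lemma isoSet_iff {S : AStr s X} {K K' : S.Kap} {g : Equiv.Perm X} :
    g ∈ IsoSet S.lett (act K) (act K') ↔ ((∀ x, g (S.mate x) = S.mate (g x)) ∧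
      ∀ x, S.lett (g x) = S.lett x) ∧ ∀ x, g (K.k x) = K'.k (g x) := by
  constructor
  · rintro ⟨h1, h2⟩
    refine ⟨⟨fun x => ?_, h2⟩, fun x => ?_⟩
    · have := h1 (FreeGroup.of true) x
      rwa [act_true, act_true] at this
    · have := h1 (FreeGroup.of false) x
      rwa [act_false, act_false] at this
  · rintro ⟨⟨h1, h2⟩, h3⟩
    refine ⟨fun γ x => ?_, h2⟩
    refine act_rel (R := fun u v => g u = v) ?_ ?_ γ x (g x) rfl
    · rintro u v rfl; exact h1 u
    · rintro u v rfl; exact h3 u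

/-- the mate permutation -/
def mP : Equiv.Perm X := Function.Involutive.toPerm S.mate S.mate_mate

lemma mP_apply (x : X) : S.mP x = S.mate x := rfl

lemma mP_mul : S.mP * S.mP = 1 := by
  ext x; exact S.mate_mate x

/-- action generated by the mate permutation -/
def actM : FreeGroup Unit →* Equiv.Perm X := FreeGroup.lift fun _ => S.mP

lemma actM_of (u : Unit) : S.actM (FreeGroup.of u) = S.mP := by simp [actM]

lemma actM_cases (γ : FreeGroup Unit) : S.actM γ = 1 ∨ S.actM γ = S.mP := by
  induction γ using FreeGroup.induction_on with
  | C1 => left; simp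
  | of b => right; exact S.actM_of b
  | inv_of b _ =>
    right
    rw [map_inv, actM_of, inv_eq_iff_mul_eq_one]
    exact S.mP_mul
  | mul a b ha hb =>
    rw [map_mul]
    rcases ha with ha | ha <;> rcases hb with hb | hb <;> rw [ha, hb] <;> simp [mP_mul]

lemma isoSetM_iff {g : Equiv.Perm X} :
    g ∈ IsoSet S.lett S.actM S.actM ↔ ((∀ x, g (S.mate x) = S.mate (g x)) ∧
      ∀ x, S.lett (g x) = S.lett x) := by
  constructor
  · rintro ⟨h1, h2⟩
    refine ⟨fun x => ?_, h2⟩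
    have := h1 (FreeGroup.of ()) x
    rwa [actM_of] at this
  · rintro ⟨h1, h2⟩
    refine ⟨fun γ x => ?_, h2⟩
    rcases S.actM_cases γ with h | h <;> rw [h]
    · rfl
    · exact h1 x

lemma lett_mate_snd (x : X) : (S.lett (S.mate x)).2 = !(S.lett x).2 := by
  rw [S.lett_mate]; rfl

lemma lett_mate_fst (x : X) : (S.lett (S.mate x)).1 = (S.lett x).1 := by
  rw [S.lett_mate]; rfl

/-- tails -/
abbrev Tl : Type := {x : X // (S.lett x).2 = false}

lemma transvM : Transv S.actM (fun a : S.Tl => a.1) := by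
  intro x
  have key : ∀ y : S.Tl, (∃ γ, x = S.actM γ y.1) → x = y.1 ∨ x = S.mate y.1 := by
    rintro y ⟨γ, h⟩
    rcases S.actM_cases γ with h1 | h1 <;> rw [h1] at h
    · exact Or.inl h
    · exact Or.inr h
  cases hx : (S.lett x).2
  · refine ⟨⟨x, hx⟩, ⟨1, by simp⟩, ?_⟩
    intro y hy
    rcases key y hy with h | h
    · exact Subtype.ext h.symm
    · rw [h, lett_mate_snd, y.2] at hx; simp at hx
  · refine ⟨⟨S.mate x, by rw [lett_mate_snd, hx]; rfl⟩, ⟨FreeGroup.of (), ?_⟩, ?_⟩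
    · rw [actM_of, mP_apply, S.mate_mate]
    · intro y hy
      rcases key y hy with h | h
      · rw [h, y.2] at hx; simp at hx
      · apply Subtype.ext
        show y.1 = S.mate x
        rw [h, S.mate_mate]

lemma mate_ne2 (x : X) : S.mate x ≠ x := by
  intro h
  have := S.lett_mate_snd x
  rw [h] at this
  simp at this

lemma prod_toFinset_univ {Ω : Type} [Fintype Ω] [DecidableEq Ω] (N : Multiset Ω) :
    ∏ ω ∈ N.toFinset, (N.count ω).factorial = ∏ ω, (N.count ω).factorial := by
  refine Finset.prod_subset (Finset.subset_univ _) ?_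
  intro j _ hj
  rw [Multiset.mem_toFinset] at hj
  rw [Multiset.count_eq_zero_of_notMem hj, Nat.factorial_zero]

variable [Fintype X]

lemma orbCountM (a b : S.Tl) : orbCount S.lett S.actM S.actM a.1 b.1 =
    if (S.lett a.1).1 = (S.lett b.1).1 then 1 else 0 := by
  have hall : ∀ y : X, ((∃ γ, y = S.actM γ b.1) ∧ PtIso S.lett S.actM S.actM a.1 y) →
      y = b.1 ∧ (S.lett a.1).1 = (S.lett b.1).1 := by
    rintro y ⟨⟨γ, h⟩, hp⟩
    have h2 := (hp 1).2
    simp only [map_one, Equiv.Perm.one_apply] at h2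
    rcases S.actM_cases γ with h1 | h1 <;> rw [h1] at h
    · have h : y = b.1 := h
      subst h
      exact ⟨rfl, by rw [h2]⟩
    · rw [mP_apply] at h
      have h3 := a.2
      rw [h2, h, lett_mate_snd, b.2] at h3
      simp at h3
  unfold orbCount
  by_cases hab : (S.lett a.1).1 = (S.lett b.1).1
  · rw [if_pos hab, Fintype.card_eq_one_iff]
    have hl : S.lett a.1 = S.lett b.1 := Prod.ext hab (by rw [a.2, b.2])
    refine ⟨⟨b.1, ⟨1, by simp⟩, ?_⟩, fun y => Subtype.ext (hall _ y.2).1⟩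
    intro γ
    rcases S.actM_cases γ with h1 | h1 <;> rw [h1]
    · simp [hl]
    · simp only [mP_apply]
      refine ⟨⟨fun h => absurd h (S.mate_ne2 _), fun h => absurd h (S.mate_ne2 _)⟩, ?_⟩
      rw [S.lett_mate, S.lett_mate, hl]
  · rw [if_neg hab, Fintype.card_eq_zero_iff]
    exact ⟨fun y => hab (hall _ y.2).2⟩

theorem card_G : Nat.card {g : Equiv.Perm X // (∀ x, g (S.mate x) = S.mate (g x)) ∧
      ∀ x, S.lett (g x) = S.lett x} =
    ∏ j : Fin s, (Nat.card {x : X // (S.lett x).2 = false ∧ (S.lett x).1 = j}).factorial := by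
  have h := card_iso_types (lett := S.lett) S.transvM S.transvM
    (fun a => (S.lett a.1).1) (fun a => (S.lett a.1).1) (fun _ => 1)
    (fun a b => (S.orbCountM a b).trans (by congr!)) _ rfl rfl
  rw [← Nat.card_eq_fintype_card] at h
  have e : Nat.card {g : Equiv.Perm X // (∀ x, g (S.mate x) = S.mate (g x)) ∧
      ∀ x, S.lett (g x) = S.lett x} = Nat.card (IsoSet S.lett S.actM S.actM) :=
    Nat.card_congr (Equiv.subtypeEquivRight fun g => S.isoSetM_iff.symm)
  rw [e, h]
  simp only [Multiset.map_const', Multiset.prod_replicate, one_pow, mul_one]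
  have hc : ∀ j : Fin s, Multiset.count j
      ((Finset.univ : Finset S.Tl).val.map fun a => (S.lett a.1).1) =
      Nat.card {x : X // (S.lett x).2 = false ∧ (S.lett x).1 = j} := by
    intro j
    rw [Multiset.count_map, ← Finset.filter_val, Finset.card_val, ← Fintype.card_subtype,
      ← Nat.card_eq_fintype_card]
    refine Nat.card_congr ((Equiv.subtypeSubtypeEquivSubtypeInter
      (fun x => (S.lett x).2 = false) (fun x => j = (S.lett x).1)).trans
      (Equiv.subtypeEquivRight fun x => and_congr_right fun _ => eq_comm))
  refine Eq.trans (@prod_toFinset_univ (Fin s) _ (fun a b => Classical.propDecidable _) _) ?_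
  exact Finset.prod_congr rfl fun j _ => by rw [← hc j]; congr!

theorem PSys.iso_natCard {S : AStr s X} {K K' : S.Kap} {A B : Type} [Fintype A] [Fintype B]
    (P : PSys K A) (P' : PSys K' B) (Q : QuadData s) (L : Fin Q.q → Multiset ℕ) (hQ : Q.IsQuad)
    (hL : ∀ j, ∀ x ∈ L j, 0 < x)
    (h1 : Multiset.Rel weqT (P.W true) Q.mB)
    (h2 : Multiset.Rel weqCT (P.W false)
      (∑ j, (L j).map fun lam => (List.replicate lam (Q.c j)).flatten))
    (h1' : Multiset.Rel weqT (P'.W true) Q.mB)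
    (h2' : Multiset.Rel weqCT (P'.W false)
      (∑ j, (L j).map fun lam => (List.replicate lam (Q.c j)).flatten)) :
    Nat.card (IsoSet S.lett (act K) (act K')) =
      (∏ i : Fin Q.p, (Q.β i).factorial) * ∏ j : Fin Q.q, cPart (L j) := by
  rw [Nat.card_eq_fintype_card]
  exact PSys.iso_card Q L P P' hQ hL h1 h2 h1' h2'

end AStr

namespace TabSub

variable {A : Type} [CommRing A] {ι : Type} [Fintype ι] [DecidableEq ι] {n : ι → ℕ} {s : ℕ}

lemma map_univ_coe {α β : Type} (R : Finset α) (f : α → β) :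
    (Finset.univ : Finset R).val.map (fun a => f a.1) = R.val.map f := by
  rw [Finset.univ_eq_attach, Finset.attach_val]
  exact Multiset.attach_map_val' R.val f

lemma exists_PSys (T : TabSub A ι n s) {q1 q2 : ι} (hq : q1 ≠ q2) (hn : n q1 = n q2)
    (π : Equiv.Perm (Fin (n q2))) (Ro Rcl : Finset (List (TabCell n)))
    (hRo : (T.tw q2 π).OpenReps q1 q2 Ro) (hRcl : (T.tw q2 π).ClosedReps q1 q2 Rcl) :
    ∃ P : AStr.PSys (T.aK hq hn π) (Ro ⊕ Rcl),
      P.W true = (T.tw q2 π).wordsOf Ro ∧ P.W false = (T.tw q2 π).wordsOf Rcl := by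
  choose fo hfo using fun a : Ro => T.open_lift π a.1 (hRo.1 a.1 a.2)
  choose fc hfc using fun a : Rcl => T.closed_lift π a.1 (hRcl.1 a.1 a.2)
  refine ⟨⟨Sum.elim fo fc, Sum.elim (fun _ => true) (fun _ => false), ?_, ?_⟩, ?_, ?_⟩
  · rintro (a | a)
    · show AStr.IsP _ true (fo a)
      rw [← isOpen_emb T hq hn, hfo]
      exact hRo.1 a.1 a.2
    · show AStr.IsP _ false (fc a)
      rw [← isClosed_emb T hq hn, hfc]
      exact hRcl.1 a.1 a.2
  · intro o l hl
    cases o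
    · rw [← isClosed_emb T hq hn] at hl
      obtain ⟨l', ⟨h1, h2⟩, h3⟩ := hRcl.2 _ hl
      refine ⟨Sum.inr ⟨l', h1⟩, ⟨rfl, ?_⟩, ?_⟩
      · show AStr.eqvP _ false l (fc _)
        rw [← tw_eqCT T q1 q2 π, hfc]
        exact h2
      · rintro (a | a) ⟨ha, ha2⟩
        · simp at ha
        · change AStr.eqvP _ false l (fc _) at ha2
          rw [← tw_eqCT T q1 q2 π, hfc] at ha2
          congr 1
          exact Subtype.ext (h3 a.1 ⟨a.2, ha2⟩)
    · rw [← isOpen_emb T hq hn] at hl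
      obtain ⟨l', ⟨h1, h2⟩, h3⟩ := hRo.2 _ hl
      refine ⟨Sum.inl ⟨l', h1⟩, ⟨rfl, ?_⟩, ?_⟩
      · show AStr.eqvP _ true l (fo _)
        rw [← tw_eqT T q1 q2 π, hfo]
        exact h2
      · rintro (a | a) ⟨ha, ha2⟩
        · change AStr.eqvP _ true l (fo _) at ha2
          rw [← tw_eqT T q1 q2 π, hfo] at ha2
          congr 1
          exact Subtype.ext (h3 a.1 ⟨a.2, ha2⟩)
        · simp at ha
  · unfold AStr.PSys.W
    have e : (Finset.univ.filter fun a : Ro ⊕ Rcl =>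
        Sum.elim (fun _ => true) (fun _ => false) a = true) =
        Finset.univ.map Function.Embedding.inl := by
      ext a; rcases a with a | a <;> simp
    refine Eq.trans (congrArg (fun t : Finset _ => Multiset.map _ t.val) (Eq.trans ?_ e)) ?_
    · congr!
    · show Multiset.map _ (Finset.map _ _).val = _
      rw [Finset.map_val, Multiset.map_map]
      unfold wordsOf
      rw [← map_univ_coe _ (T.tw q2 π).word]
      refine Multiset.map_congr rfl fun a _ => ?_
      rw [← hfo a, tw_word_emb]
      rfl
  · unfold AStr.PSys.W
    have e : (Finset.univ.filter fun a : Ro ⊕ Rcl =>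
        Sum.elim (fun _ => true) (fun _ => false) a = false) =
        Finset.univ.map Function.Embedding.inr := by
      ext a; rcases a with a | a <;> simp
    refine Eq.trans (congrArg (fun t : Finset _ => Multiset.map _ t.val) (Eq.trans ?_ e)) ?_
    · congr!
    · show Multiset.map _ (Finset.map _ _).val = _
      rw [Finset.map_val, Multiset.map_map]
      unfold wordsOf
      rw [← map_univ_coe _ (T.tw q2 π).word]
      refine Multiset.map_congr rfl fun a _ => ?_
      rw [← hfc a, tw_word_emb]
      rfl

/-- cells of the column `q2` -/
def x2 (T : TabSub A ι n s) (q1 q2 : ι) (j : Fin (n q2)) : T.XT q1 q2 :=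
  ⟨⟨q2, j⟩, Or.inr (Or.inl rfl)⟩

/-- cells of the column `q1` -/
def x1 (T : TabSub A ι n s) {q1 q2 : ι} (hn : n q1 = n q2) (j : Fin (n q2)) : T.XT q1 q2 :=
  ⟨⟨q1, Fin.cast hn.symm j⟩, Or.inl rfl⟩

lemma x1_inj (T : TabSub A ι n s) {q1 q2 : ι} (hn : n q1 = n q2) :
    Function.Injective (T.x1 (q1 := q1) (q2 := q2) hn) := by
  intro i j h
  have := congrArg Subtype.val h
  simpa [x1] using this

lemma x2_inj (T : TabSub A ι n s) (q1 q2 : ι) : Function.Injective (T.x2 q1 q2) := by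
  intro i j h
  have := congrArg Subtype.val h
  simpa [x2] using this

lemma side_x2 (T : TabSub A ι n s) {q1 q2 : ι} (hq : q1 ≠ q2) (j : Fin (n q2)) :
    (T.aS q1 q2).side (T.x2 q1 q2 j) = some true := by
  rw [aS_side]; simp [x2, csd, hq.symm]

lemma side_x1 (T : TabSub A ι n s) {q1 q2 : ι} (hn : n q1 = n q2) (j : Fin (n q2)) :
    (T.aS q1 q2).side (T.x1 hn j) = some false := by
  rw [aS_side]; simp [x1, csd]

lemma x_cases (T : TabSub A ι n s) {q1 q2 : ι} (hq : q1 ≠ q2) (hn : n q1 = n q2)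
    (x : T.XT q1 q2) : (∃ i, x = T.x1 hn i) ∨ (∃ j, x = T.x2 q1 q2 j) ∨
      (T.aS q1 q2).side x = none := by
  rcases cell_cases q1 q2 x.1 with ⟨i, hi⟩ | ⟨j, hj⟩ | h
  · exact Or.inl ⟨Fin.cast hn i, Subtype.ext (by rw [hi]; rfl)⟩
  · exact Or.inr (Or.inl ⟨j, Subtype.ext hj⟩)
  · right; right
    rw [aS_side, csd_none]; exact h

lemma k_x2 (T : TabSub A ι n s) {q1 q2 : ι} (hq : q1 ≠ q2) (hn : n q1 = n q2)
    (π : Equiv.Perm (Fin (n q2))) (j : Fin (n q2)) :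
    (T.aK hq hn π).k (T.x2 q1 q2 j) = T.x1 hn (π j) := Subtype.ext (kc_q2 hq hn π j)

lemma k_x1 (T : TabSub A ι n s) {q1 q2 : ι} (hq : q1 ≠ q2) (hn : n q1 = n q2)
    (π : Equiv.Perm (Fin (n q2))) (j : Fin (n q2)) :
    (T.aK hq hn π).k (T.x1 hn (π j)) = T.x2 q1 q2 j := by
  rw [← k_x2 T hq, (T.aK hq hn π).kk]

lemma exists_unique_pi (T : TabSub A ι n s) {q1 q2 : ι} (hq : q1 ≠ q2) (hn : n q1 = n q2)
    (τ : Equiv.Perm (Fin (n q2))) (g : Equiv.Perm (T.XT q1 q2))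
    (hg : ∀ x, (T.aS q1 q2).lett (g x) = (T.aS q1 q2).lett x) :
    ∃! π, ∀ x, g ((T.aK hq hn τ).k x) = (T.aK hq hn π).k (g x) := by
  have hs : ∀ x, (T.aS q1 q2).side (g x) = (T.aS q1 q2).side x := fun x => by
    unfold AStr.side; rw [hg]
  have hs' : ∀ x, (T.aS q1 q2).side (g.symm x) = (T.aS q1 q2).side x := fun x => by
    rw [← hs, Equiv.apply_symm_apply]
  have h1 : ∀ j, ∃ i, g ((T.aK hq hn τ).k (g.symm (T.x2 q1 q2 j))) = T.x1 hn i := by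
    intro j
    have h2 : (T.aS q1 q2).side (g.symm (T.x2 q1 q2 j)) = some true := by
      rw [hs', side_x2 T hq]
    have h3 := (T.aK hq hn τ).k_some _ (by rw [h2]; simp)
    rw [← hs, h2] at h3
    rcases T.x_cases hq hn (g ((T.aK hq hn τ).k (g.symm (T.x2 q1 q2 j)))) with h | ⟨i, hi⟩ | h
    · exact h
    · rw [hi, side_x2 T hq] at h3; simp at h3
    · exact absurd h h3.1
  choose f hf using h1
  have kinj : Function.Injective (T.aK hq hn τ).k := fun x y h => by
    rw [← (T.aK hq hn τ).kk x, h, (T.aK hq hn τ).kk]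
  have finj : Function.Injective f := by
    intro i j hij
    have h := hf i
    rw [hij, ← hf j] at h
    exact T.x2_inj q1 q2 (g.symm.injective (kinj (g.injective h)))
  let π : Equiv.Perm (Fin (n q2)) := Equiv.ofBijective f (Finite.injective_iff_bijective.1 finj)
  have hπ : ∀ j, π j = f j := fun j => rfl
  have key : ∀ y, g ((T.aK hq hn τ).k (g.symm y)) = (T.aK hq hn π).k y := by
    intro y
    rcases T.x_cases hq hn y with ⟨i, rfl⟩ | ⟨j, rfl⟩ | h
    · obtain ⟨j, rfl⟩ := π.surjective i
      rw [k_x1, hπ, ← hf j]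
      simp [(T.aK hq hn τ).kk]
    · rw [k_x2, hf]; rfl
    · rw [(T.aK hq hn π).k_none _ h, (T.aK hq hn τ).k_none _ (by rw [hs', h]),
        Equiv.apply_symm_apply]
  refine ⟨π, fun x => ?_, ?_⟩
  · have := key (g x)
    rwa [Equiv.symm_apply_apply] at this
  · intro π' h
    ext1 j
    apply T.x1_inj hn
    rw [← k_x2 T hq, ← k_x2 T hq, ← key]
    have := h (g.symm (T.x2 q1 q2 j))
    rw [Equiv.apply_symm_apply] at this
    exact this.symm

theorem card_fibre (T : TabSub A ι n s) {q1 q2 : ι} (hq : q1 ≠ q2) (hn : n q1 = n q2)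
    (τ : Equiv.Perm (Fin (n q2))) :
    Nat.card {g : Equiv.Perm (T.XT q1 q2) //
      (∀ x, g ((T.aS q1 q2).mate x) = (T.aS q1 q2).mate (g x)) ∧
      ∀ x, (T.aS q1 q2).lett (g x) = (T.aS q1 q2).lett x} =
    ∑ π : Equiv.Perm (Fin (n q2)),
      Nat.card (IsoSet (T.aS q1 q2).lett (AStr.act (T.aK hq hn τ)) (AStr.act (T.aK hq hn π))) := by
  rw [← Nat.card_sigma]
  symm
  refine Nat.card_eq_of_bijective
    (fun p => ⟨p.2.1, (AStr.isoSet_iff.1 p.2.2).1⟩) ⟨?_, ?_⟩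
  · rintro ⟨π, g, hg⟩ ⟨π', g', hg'⟩ h
    have h : g = g' := congrArg Subtype.val h
    subst h
    have : π = π' := (T.exists_unique_pi hq hn τ g (AStr.isoSet_iff.1 hg).1.2).unique
      (AStr.isoSet_iff.1 hg).2 (AStr.isoSet_iff.1 hg').2
    subst this
    rfl
  · rintro ⟨g, hg⟩
    obtain ⟨π, hπ, _⟩ := T.exists_unique_pi hq hn τ g hg.2
    exact ⟨⟨π, g, AStr.isoSet_iff.2 ⟨hg, hπ⟩⟩, rfl⟩

lemma rel_trans {α : Type} {r : α → α → Prop} (hr : ∀ x y z, r x y → r y z → r x z)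
    {a b c : Multiset α} (h1 : Multiset.Rel r a b) (h2 : Multiset.Rel r b c) :
    Multiset.Rel r a c := by
  have : IsTrans α r := ⟨hr⟩
  exact Multiset.Rel.trans r h1 h2

theorem main (T : TabSub A ι n s) {q1 q2 : ι} (hq : q1 ≠ q2) (hn : n q1 = n q2)
    (Ro Rcl : Equiv.Perm (Fin (n q2)) → Finset (List (TabCell n)))
    (hRo : ∀ τ, (T.tw q2 τ).OpenReps q1 q2 (Ro τ))
    (hRcl : ∀ τ, (T.tw q2 τ).ClosedReps q1 q2 (Rcl τ))
    (τ : Equiv.Perm (Fin (n q2)))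
    (Q : QuadData s) (hQ : Q.IsQuad)
    (hB : Multiset.Rel weqT ((T.tw q2 τ).wordsOf (Ro τ)) Q.mB)
    (L : Fin Q.q → Multiset ℕ)
    (hL₁ : ∀ j, ∀ x ∈ L j, 0 < x)
    (hL₂ : Multiset.Rel weqCT ((T.tw q2 τ).wordsOf (Rcl τ))
      (∑ j, (L j).map fun lam => (List.replicate lam (Q.c j)).flatten)) :
    (Finset.univ.filter fun π => π ∈ T.SPerm q1 q2 Ro Rcl τ).card *
      ((∏ i : Fin Q.p, (Q.β i).factorial) * ∏ j : Fin Q.q, cPart (L j)) =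
    ∏ j : Fin s, (T.tails.filter fun c => T.lab c = j ∧
      (c.1 = q1 ∨ c.1 = q2 ∨ (T.mate c).1 = q1 ∨ (T.mate c).1 = q2)).card.factorial := by
  have hG := (T.aS q1 q2).card_G
  rw [card_fibre T hq hn τ] at hG
  have hR : ∀ j : Fin s, (T.tails.filter fun c => T.lab c = j ∧
      (c.1 = q1 ∨ c.1 = q2 ∨ (T.mate c).1 = q1 ∨ (T.mate c).1 = q2)).card =
      Nat.card {x : T.XT q1 q2 //
        ((T.aS q1 q2).lett x).2 = false ∧ ((T.aS q1 q2).lett x).1 = j} := by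
    intro j
    unfold tails
    rw [Finset.filter_filter, ← Fintype.card_subtype, ← Nat.card_eq_fintype_card]
    refine Nat.card_congr (Equiv.symm ((Equiv.subtypeSubtypeEquivSubtypeInter
      (fun c : TabCell n => c.1 = q1 ∨ c.1 = q2 ∨ (T.mate c).1 = q1 ∨ (T.mate c).1 = q2)
      (fun c => (T.letter c).2 = false ∧ (T.letter c).1 = j)).trans
      (Equiv.subtypeEquivRight fun c => ?_)))
    simp only [letter, Bool.not_eq_false']
    tauto
  rw [Finset.prod_congr rfl fun j _ => congrArg Nat.factorial (hR j), ← hG]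
  obtain ⟨P, hP1, hP2⟩ := T.exists_PSys hq hn τ (Ro τ) (Rcl τ) (hRo τ) (hRcl τ)
  rw [Finset.card_eq_sum_ones, Finset.sum_mul, Finset.sum_filter]
  refine Finset.sum_congr rfl fun π _ => ?_
  obtain ⟨P', hP1', hP2'⟩ := T.exists_PSys hq hn π (Ro π) (Rcl π) (hRo π) (hRcl π)
  split_ifs with h
  · have e1 : Multiset.Rel weqT (P.W true) Q.mB := by rw [hP1]; exact hB
    have e2 : Multiset.Rel weqCT (P.W false)
        (∑ j, (L j).map fun lam => (List.replicate lam (Q.c j)).flatten) := by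
      rw [hP2]; exact hL₂
    have e3 : Multiset.Rel weqT (P'.W true) Q.mB := by
      rw [hP1']; exact rel_trans (r := weqT) (fun _ _ _ a b => weqT_trans a b) h.1 hB
    have e4 : Multiset.Rel weqCT (P'.W false)
        (∑ j, (L j).map fun lam => (List.replicate lam (Q.c j)).flatten) := by
      rw [hP2']; exact rel_trans (r := weqCT) (fun _ _ _ a b => weqCT_trans a b) h.2 hL₂
    have e5 := AStr.PSys.iso_natCard P P' Q L hQ hL₁ e1 e2 e3 e4
    rw [one_mul, e5]
  · symm
    rw [Nat.card_eq_zero]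
    left
    rw [Set.isEmpty_coe_sort, ← Set.not_nonempty_iff_eq_empty]
    intro hne
    apply h
    have e1 := P.iso_rel P' hne true
    have e2 := P.iso_rel P' hne false
    rw [hP1, hP1'] at e1
    rw [hP2, hP2'] at e2
    exact ⟨e1, e2⟩

end TabSub

open TabSub in
/-- `#S_τ = c_T^{(q_1,q_2)} / (β! · c(λ(τ)))` for `τ ∈ S_{β,γ,b,c}`, stated in the
multiplied-out form `#S_τ · β! · c(λ(τ)) = c_T^{(q_1,q_2)}`. -/
theorem stmt18 (A : Type) [CommRing A] (m s : ℕ) (n : Fin (m + 2) → ℕ)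
    -- the distinguished columns are the last two: `q1 = m−1`, `q2 = m` (1-based)
    (q1 q2 : Fin (m + 2)) (hq1 : q1 = ⟨m, by omega⟩) (hq2 : q2 = ⟨m + 1, by omega⟩)
    (hn : n q1 = n q2)
    (T : TabSub A (Fin (m + 2)) n s)
    (Ro Rcl : Equiv.Perm (Fin (n q2)) → Finset (List (TabCell n)))
    (hRo : ∀ τ, (T.tw q2 τ).OpenReps q1 q2 (Ro τ))
    (hRcl : ∀ τ, (T.tw q2 τ).ClosedReps q1 q2 (Rcl τ))
    (τ : Equiv.Perm (Fin (n q2)))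
    -- the `T`-admissible quadruple `(β,γ,b,c)` with `τ ∈ S_{β,γ,b,c}`
    (Q : QuadData s) (hadm : T.Admissible q1 q2 hn Ro Rcl Q)
    (hτQ : T.SQuadMem q1 q2 Ro Rcl Q τ)
    -- `λ(τ)`: the multi-partition of `γ` determined by `φ(T^τ_cl)`
    (L : Fin Q.q → Multiset ℕ)
    (hL₁ : ∀ j, (∀ x ∈ L j, 0 < x) ∧ (L j).sum = Q.γ j)
    (hL₂ : Multiset.Rel weqCT ((T.tw q2 τ).wordsOf (Rcl τ))
      (∑ j, (L j).map fun lam => (List.replicate lam (Q.c j)).flatten)) :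
    (Finset.univ.filter fun π => π ∈ T.SPerm q1 q2 Ro Rcl τ).card *
      ((∏ i : Fin Q.p, (Q.β i).factorial) * ∏ j : Fin Q.q, cPart (L j)) =
    ∏ j : Fin s, (T.tails.filter fun c => T.lab c = j ∧
      (c.1 = q1 ∨ c.1 = q2 ∨ (T.mate c).1 = q1 ∨ (T.mate c).1 = q2)).card.factorial := by
  have hq : q1 ≠ q2 := by
    rw [hq1, hq2]
    simp [Fin.ext_iff]
  have h := TabSub.main T hq hn Ro Rcl hRo hRcl τ Q hadm.1 hτQ.1 L (fun j => (hL₁ j).1) hL₂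
  convert h
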